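/- arXiv:1902.02387 — 2 statements merged into one kernel-verified Lean document; each statement's English description precedes it below -/
import Mathlib

section
/- In the abstract setup, let (𝓐, 𝓑) be a cotorsion pair in 𝓜. Then for every j ∈ J and every A ∈ 𝓐, the object S_j(A) lies in ⊥Ψ(𝓑); that is, Ext¹_𝓧(S_j(A), Y) = 0 for every Y ∈ Ψ(𝓑). -/
/-!
Statement 13 (Lemma 5.1): if `(𝓐, 𝓑)` is a cotorsion pair in `𝓜`, then `S_j(A) ∈ ⊥Ψ(𝓑)` for every `j ∈ J` and `A ∈ 𝓐`.
(Holm–Jørgensen, "Model categories of quiver representations".)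
-/

open CategoryTheory CategoryTheory.Limits CategoryTheory.Abelian

universe w w' v u v' u'

section Defs

variable {𝓨 : Type u} [Category.{v} 𝓨] [Abelian 𝓨] [HasExt.{w} 𝓨]

/-- `Γ^⊥ = {Y | Ext¹(C, Y) = 0 for all C ∈ Γ}`. -/
def rightPerp (Γ : Set 𝓨) : Set 𝓨 :=
  {Y | ∀ C ∈ Γ, Subsingleton (Ext C Y 1)}

/-- `⊥Δ = {Y | Ext¹(Y, D) = 0 for all D ∈ Δ}`. -/
def leftPerp (Δ : Set 𝓨) : Set 𝓨 :=
  {Y | ∀ D ∈ Δ, Subsingleton (Ext Y D 1)}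

/-- `(Γ, Δ)` is a cotorsion pair if `Γ = ⊥Δ` and `Γ^⊥ = Δ`. -/
def IsCotorsionPair (Γ Δ : Set 𝓨) : Prop :=
  Γ = leftPerp Δ ∧ rightPerp Γ = Δ

/-- `Γ` is closed under kernels of epimorphisms. -/
def ClosedUnderKernelsOfEpis (Γ : Set 𝓨) : Prop :=
  ∀ ⦃X Y : 𝓨⦄ (f : X ⟶ Y), Epi f → X ∈ Γ → Y ∈ Γ → (kernel f : 𝓨) ∈ Γ

/-- `Δ` is closed under cokernels of monomorphisms. -/
def ClosedUnderCokernelsOfMonos (Δ : Set 𝓨) : Prop :=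
  ∀ ⦃X Y : 𝓨⦄ (f : X ⟶ Y), Mono f → X ∈ Δ → Y ∈ Δ → (cokernel f : 𝓨) ∈ Δ

/-- A cotorsion pair `(Γ, Δ)` is hereditary if `Γ` is closed under kernels of
epimorphisms and `Δ` is closed under cokernels of monomorphisms. -/
def IsHereditary (Γ Δ : Set 𝓨) : Prop :=
  ClosedUnderKernelsOfEpis Γ ∧ ClosedUnderCokernelsOfMonos Δ

end Defs

section Setup

variable {𝓜 : Type u} [Category.{v} 𝓜] [Abelian 𝓜]
  [EnoughProjectives 𝓜] [EnoughInjectives 𝓜] [HasExt.{w} 𝓜]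
variable {𝓧 : Type u'} [Category.{v'} 𝓧] [Abelian 𝓧]
  [EnoughProjectives 𝓧] [EnoughInjectives 𝓧] [HasExt.{w'} 𝓧]
variable {J : Type*} (Cf Kf : J → (𝓧 ⥤ 𝓜)) (Sf : J → (𝓜 ⥤ 𝓧))

/-- `Φ(𝓒) = {X | ∀ j, C_j(X) ∈ 𝓒 and L₁C_j(X) = 0}`. -/
def Phi [∀ j, (Cf j).Additive] (𝓒 : Set 𝓜) : Set 𝓧 :=
  {X | ∀ j, (Cf j).obj X ∈ 𝓒 ∧ IsZero (((Cf j).leftDerived 1).obj X)}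

/-- `Ψ(𝓒) = {X | ∀ j, K_j(X) ∈ 𝓒 and R¹K_j(X) = 0}`. -/
def Psi [∀ j, (Kf j).Additive] (𝓒 : Set 𝓜) : Set 𝓧 :=
  {X | ∀ j, (Kf j).obj X ∈ 𝓒 ∧ IsZero (((Kf j).rightDerived 1).obj X)}

/-- `𝓔_L = {X | ∀ j, L₁C_j(X) = 0}`. -/
def EL [∀ j, (Cf j).Additive] : Set 𝓧 :=
  {X | ∀ j, IsZero (((Cf j).leftDerived 1).obj X)}

/-- `𝓔_R = {X | ∀ j, R¹K_j(X) = 0}`. -/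
def ER [∀ j, (Kf j).Additive] : Set 𝓧 :=
  {X | ∀ j, IsZero (((Kf j).rightDerived 1).obj X)}

end Setup

section

variable {𝓒 : Type u} [Category.{v} 𝓒] [Abelian 𝓒]
  {𝓓 : Type u'} [Category.{v'} 𝓓] [Abelian 𝓓]

/-- If `0 ⟶ X₁ ⟶ X₂ ⟶ X₃ ⟶ 0` is short exact and `Ext¹(A, X₁)` vanishes, then every morphism
from `A` to `X₃` lifts to `X₂`. -/
lemma CategoryTheory.ShortComplex.ShortExact.exists_lift_of_subsingleton_ext [HasExt.{w} 𝓒]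
    {S : ShortComplex 𝓒} (hS : S.ShortExact) {A : 𝓒} [Subsingleton (Ext A S.X₁ 1)]
    (f : A ⟶ S.X₃) : ∃ g : A ⟶ S.X₂, g ≫ S.g = f := by
  obtain ⟨x, hx⟩ := Ext.covariant_sequence_exact₃ A hS (Ext.mk₀ f) (zero_add 1)
    (Subsingleton.elim _ _)
  obtain ⟨g, rfl⟩ := (Ext.mk₀_bijective A S.X₂).2 x
  exact ⟨g, (Ext.mk₀_bijective A S.X₃).1 (by rw [← hx, Ext.mk₀_comp_mk₀])⟩

/-- If `0 ⟶ X₁ ⟶ X₂ ⟶ X₃ ⟶ 0` is short exact with `X₂` injective and every morphism from `A`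
to `X₃` lifts to `X₂`, then `Ext¹(A, X₁)` vanishes. -/
lemma CategoryTheory.ShortComplex.ShortExact.subsingleton_ext_of_exists_lift [HasExt.{w} 𝓒]
    {S : ShortComplex 𝓒} (hS : S.ShortExact) [Injective S.X₂] {A : 𝓒}
    (hA : ∀ f : A ⟶ S.X₃, ∃ g : A ⟶ S.X₂, g ≫ S.g = f) : Subsingleton (Ext A S.X₁ 1) := by
  refine subsingleton_of_forall_eq 0 fun x ↦ ?_
  obtain ⟨y, rfl⟩ := Ext.covariant_sequence_exact₁ A hS x (Ext.eq_zero_of_injective _)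
    (zero_add 1)
  obtain ⟨f, rfl⟩ := (Ext.mk₀_bijective A S.X₃).2 y
  obtain ⟨g, rfl⟩ := hA f
  rw [← Ext.mk₀_comp_mk₀, Ext.comp_assoc_of_second_deg_zero, hS.comp_extClass, Ext.comp_zero]

/-- The cosyzygy sequence `0 ⟶ Y ⟶ I⁰ ⟶ Z ⟶ 0` of an injective resolution is short exact. -/
lemma CategoryTheory.InjectiveResolution.shortExact_cokernel {Y : 𝓒}
    (I : InjectiveResolution Y) :
    (ShortComplex.mk (I.ι.f 0) (cokernel.π (I.ι.f 0)) (cokernel.condition _)).ShortExact where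
  exact := ShortComplex.exact_cokernel _
  mono_f := inferInstanceAs (Mono (I.ι.f 0))
  epi_g := inferInstanceAs (Epi (cokernel.π _))

/-- If `R¹K(Y) = 0` and `K` preserves monomorphisms, then `K` preserves the cosyzygy epimorphism
`I⁰ ⟶ Z` of an injective resolution of `Y`. -/
lemma CategoryTheory.InjectiveResolution.epi_map_cokernel_π [HasInjectiveResolutions 𝓒] {Y : 𝓒}
    (I : InjectiveResolution Y) (K : 𝓒 ⥤ 𝓓) [K.Additive] [K.PreservesMonomorphisms]
    (hY : IsZero ((K.rightDerived 1).obj Y)) : Epi (K.map (cokernel.π (I.ι.f 0))) := by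
  have hexact : ((K.mapHomologicalComplex _).obj I.cocomplex).ExactAt 1 := by
    rw [HomologicalComplex.exactAt_iff_isZero_homology]
    exact hY.of_iso (I.isoRightDerivedObj K 1).symm
  rw [HomologicalComplex.exactAt_iff_exact_up_to_refinements _ 0 1 2 (by simp) (by simp)]
    at hexact
  let m := cokernel.desc (I.ι.f 0) (I.cocomplex.d 0 1) I.ι_f_zero_comp_complex_d
  have : Mono m := I.exact₀.mono_cokernelDesc
  have hm : m ≫ I.cocomplex.d 1 2 = 0 := by
    rw [← cancel_epi (cokernel.π (I.ι.f 0)), cokernel.π_desc_assoc, comp_zero,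
      HomologicalComplex.d_comp_d]
  obtain ⟨A, π, _, (x : A ⟶ K.obj (I.cocomplex.X 0)),
      (hx : π ≫ K.map m = x ≫ K.map (I.cocomplex.d 0 1))⟩ := hexact (K.map m) (by
    change K.map m ≫ K.map (I.cocomplex.d 1 2) = 0
    rw [← K.map_comp, hm, K.map_zero])
  have hπ : x ≫ K.map (cokernel.π (I.ι.f 0)) = π := by
    rw [← cancel_mono (K.map m), Category.assoc, ← K.map_comp, cokernel.π_desc, hx]
  have : Epi (x ≫ K.map (cokernel.π (I.ι.f 0))) := by rwa [hπ]
  exact epi_of_epi x _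

/-- A right adjoint `K` of `S` transfers the vanishing of `Ext¹(A, K(Y))` to that of
`Ext¹(S(A), Y)` whenever `R¹K(Y) = 0`. -/
lemma CategoryTheory.Adjunction.subsingleton_ext_one [HasExt.{w} 𝓒] [HasExt.{w'} 𝓓]
    [HasInjectiveResolutions 𝓒] {S : 𝓓 ⥤ 𝓒} {K : 𝓒 ⥤ 𝓓} [K.Additive] (adj : S ⊣ K)
    {A : 𝓓} {Y : 𝓒} (hY : IsZero ((K.rightDerived 1).obj Y))
    [Subsingleton (Ext A (K.obj Y) 1)] : Subsingleton (Ext (S.obj A) Y 1) := by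
  have : PreservesLimits K := adj.rightAdjoint_preservesLimits
  let I := injectiveResolution Y
  let T := ShortComplex.mk (I.ι.f 0) (cokernel.π (I.ι.f 0)) (cokernel.condition _)
  have hT : T.ShortExact := I.shortExact_cokernel
  have : Mono T.f := hT.mono_f
  have : Epi (T.map K).g := I.epi_map_cokernel_π K hY
  have hKT : (T.map K).ShortExact :=
    { exact := hT.exact.map_of_mono_of_preservesKernel K inferInstance inferInstance
      mono_f := inferInstanceAs (Mono (K.map T.f)) }
  have : Injective T.X₂ := I.injective 0
  have : Subsingleton (Ext A (T.map K).X₁ 1) := ‹Subsingleton (Ext A (K.obj Y) 1)›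
  refine hT.subsingleton_ext_of_exists_lift fun f ↦ ?_
  obtain ⟨(g : A ⟶ K.obj T.X₂), (hg : g ≫ K.map T.g = adj.homEquiv _ _ f)⟩ :=
    hKT.exists_lift_of_subsingleton_ext (adj.homEquiv _ _ f)
  refine ⟨(adj.homEquiv _ _).symm g, (adj.homEquiv _ _).injective ?_⟩
  rw [adj.homEquiv_naturality_right, Equiv.apply_symm_apply, hg]

end

theorem S_obj_mem_leftPerp_psi
    {𝓜 : Type u} [Category.{v} 𝓜] [Abelian 𝓜]
    [EnoughProjectives 𝓜] [EnoughInjectives 𝓜] [HasExt.{w} 𝓜]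
    {𝓧 : Type u'} [Category.{v'} 𝓧] [Abelian 𝓧]
    [EnoughProjectives 𝓧] [EnoughInjectives 𝓧] [HasExt.{w'} 𝓧]
    {J : Type*} (Cf Kf : J → (𝓧 ⥤ 𝓜)) (Sf : J → (𝓜 ⥤ 𝓧))
    [∀ j, (Cf j).Additive] [∀ j, (Kf j).Additive]
    (adjCS : ∀ j, Cf j ⊣ Sf j) (adjSK : ∀ j, Sf j ⊣ Kf j)
    (𝓐 𝓑 : Set 𝓜) (h : IsCotorsionPair 𝓐 𝓑) :
    ∀ (j : J), ∀ A ∈ 𝓐, ∀ Y ∈ Psi Kf 𝓑, Subsingleton (Ext ((Sf j).obj A) Y 1) := by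
  intro j A hA Y hY
  have : Subsingleton (Ext A ((Kf j).obj Y) 1) := by
    rw [h.1] at hA
    exact hA _ (hY j).1
  exact (adjSK j).subsingleton_ext_one (hY j).2
end

section
/- Let k be a field, R a k-algebra, and N ≥ 1 an integer. Let (𝓐, 𝓑) be a hereditary cotorsion pair in the category of left R-modules such that 𝓐 is closed under pure quotients and (𝓐, 𝓑) is generated by a set (i.e. there is a set 𝓒 of left R-modules with 𝓑 = 𝓒^⊥). Then the cotorsion pairs (Φ(𝓐), Φ(𝓐)^⊥) and (⊥Ψ(𝓑), Ψ(𝓑)) in the category 𝓧 of N-periodic chain complexes of left R-modules, where Φ(𝓐) = {X ∈ 𝓧 | for every q ∈ ℤ/N, Coker(∂_q^X) ∈ 𝓐 and H_q(X) = 0} and Ψ(𝓑) = {X ∈ 𝓧 | for every q ∈ ℤ/N, Ker(∂_q^X) ∈ 𝓑 and H_q(X) = 0}, are complete: for each such pair (Γ, Δ), every Y ∈ 𝓧 fits into short exact sequences 0 → D → C → Y → 0 and 0 → Y → D' → C' → 0 with C, C' ∈ Γ and D, D' ∈ Δ. -/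
/-!
Statement 15 (Theorem B(ii) in Holm–Jørgensen, "Model categories of quiver representations").

Let `k` be a field, `R` a `k`-algebra and `N ≥ 1`.  If `(𝓐, 𝓑)` is a hereditary cotorsion
pair of left `R`-modules such that `𝓐` is closed under pure quotients and `(𝓐, 𝓑)` is
generated by a set, then the cotorsion pairs `(Φ(𝓐), Φ(𝓐)^⊥)` and `(⊥Ψ(𝓑), Ψ(𝓑))` in the
category of `N`-periodic chain complexes of left `R`-modules are complete.
-/

open CategoryTheory CategoryTheory.Limits CategoryTheory.Abelian

universe w w' v u

/-- A cotorsion pair `(Γ, Δ)` is complete: every object `Y` fits into short exact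
sequences `0 → D → C → Y → 0` and `0 → Y → D' → C' → 0` with `C, C' ∈ Γ` and
`D, D' ∈ Δ`. -/
def IsCompleteCotorsionPair {𝓨 : Type u} [Category.{v} 𝓨] [Abelian 𝓨] (Γ Δ : Set 𝓨) : Prop :=
  ∀ Y : 𝓨,
    (∃ (D C : 𝓨) (i : D ⟶ C) (p : C ⟶ Y) (w : i ≫ p = 0),
      (CategoryTheory.ShortComplex.mk i p w).ShortExact ∧ C ∈ Γ ∧ D ∈ Δ) ∧
    (∃ (D' C' : 𝓨) (i : Y ⟶ D') (p : D' ⟶ C') (w : i ≫ p = 0),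
      (CategoryTheory.ShortComplex.mk i p w).ShortExact ∧ C' ∈ Γ ∧ D' ∈ Δ)

/-- A short exact sequence of left `R`-modules is pure if every morphism from a finitely
presented module to the third term lifts along the epimorphism; a class `𝓐` is closed
under pure quotients if the third term of any pure short exact sequence whose middle term
lies in `𝓐` again lies in `𝓐`. -/
def ClosedUnderPureQuotients (R : Type u) [Ring R] (𝓐 : Set (ModuleCat.{u} R)) : Prop :=
  ∀ (A' A A'' : ModuleCat.{u} R) (i : A' ⟶ A) (p : A ⟶ A'') (w : i ≫ p = 0),
    (CategoryTheory.ShortComplex.mk i p w).ShortExact →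
    (∀ (F : ModuleCat.{u} R), Module.FinitePresentation R F →
      ∀ g : F ⟶ A'', ∃ h : F ⟶ A, h ≫ p = g) →
    A ∈ 𝓐 → A'' ∈ 𝓐

/-- The category of `N`-periodic chain complexes of left `R`-modules: complexes indexed by
`ℤ/N` with differentials `∂_q : X_q → X_{q-1}` squaring to zero. -/
abbrev PeriodicComplexes (R : Type u) [Ring R] (N : ℕ) :=
  HomologicalComplex (ModuleCat.{u} R) (ComplexShape.down (ZMod N))

variable (R : Type u) [Ring R] (N : ℕ)

/-- `Φ(𝓐) = {X | ∀ q, Coker(∂_q^X) ∈ 𝓐 and H_q(X) = 0}`. -/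
noncomputable def PhiPeriodic (𝓐 : Set (ModuleCat.{u} R)) : Set (PeriodicComplexes R N) :=
  {X | ∀ q : ZMod N, (cokernel (X.d q (q - 1)) : ModuleCat.{u} R) ∈ 𝓐 ∧
    IsZero (X.homology q)}

/-- `Ψ(𝓑) = {X | ∀ q, Ker(∂_q^X) ∈ 𝓑 and H_q(X) = 0}`. -/
noncomputable def PsiPeriodic (𝓑 : Set (ModuleCat.{u} R)) : Set (PeriodicComplexes R N) :=
  {X | ∀ q : ZMod N, (kernel (X.d q (q - 1)) : ModuleCat.{u} R) ∈ 𝓑 ∧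
    IsZero (X.homology q)}

namespace PeriodicCotorsion

section Abelian

variable {𝓒 : Type*} [Category* 𝓒] [Abelian 𝓒]

/-- Every extension of `C` by `Y` splits. -/
def ExtSplits (C Y : 𝓒) : Prop :=
  ∀ ⦃E : 𝓒⦄ (i : Y ⟶ E) (p : E ⟶ C) (w : i ≫ p = 0), (ShortComplex.mk i p w).ShortExact →
    ∃ s : C ⟶ E, s ≫ p = 𝟙 C

lemma shortExact_mk_of_lift {X₁ X₂ X₃ : 𝓒} (i : X₁ ⟶ X₂) (p : X₂ ⟶ X₃) (w : i ≫ p = 0) [Mono i]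
    [Epi p] (hl : ∀ ⦃T : 𝓒⦄ (t : T ⟶ X₂), t ≫ p = 0 → ∃ t' : T ⟶ X₁, t' ≫ i = t) :
    (ShortComplex.mk i p w).ShortExact := by
  have hex : (ShortComplex.mk i p w).Exact :=
    ShortComplex.exact_of_f_is_kernel _ (KernelFork.IsLimit.ofι' i w fun t ht ↦
      ⟨(hl t ht).choose, (hl t ht).choose_spec⟩)
  exact { exact := hex }

lemma shortExact_mk_of_desc {X₁ X₂ X₃ : 𝓒} (i : X₁ ⟶ X₂) (p : X₂ ⟶ X₃) (w : i ≫ p = 0) [Mono i]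
    [Epi p] (hl : ∀ ⦃T : 𝓒⦄ (t : X₂ ⟶ T), i ≫ t = 0 → ∃ t' : X₃ ⟶ T, p ≫ t' = t) :
    (ShortComplex.mk i p w).ShortExact := by
  have hex : (ShortComplex.mk i p w).Exact :=
    ShortComplex.exact_of_g_is_cokernel _ (CokernelCofork.IsColimit.ofπ' p w fun t ht ↦
      ⟨(hl t ht).choose, (hl t ht).choose_spec⟩)
  exact { exact := hex }

lemma shortExact_mk_kernel {X₂ X₃ : 𝓒} (p : X₂ ⟶ X₃) [Epi p] :
    (ShortComplex.mk (kernel.ι p) p (kernel.condition p)).ShortExact :=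
  shortExact_mk_of_lift _ _ _ fun _ t ht ↦ ⟨kernel.lift p t ht, by simp⟩

lemma shortExact_mk_cokernel {X₁ X₂ : 𝓒} (i : X₁ ⟶ X₂) [Mono i] :
    (ShortComplex.mk i (cokernel.π i) (cokernel.condition i)).ShortExact :=
  shortExact_mk_of_desc _ _ _ fun _ t ht ↦ ⟨cokernel.desc i t ht, by simp⟩

lemma ShortExact.exists_lift {X₁ X₂ X₃ T : 𝓒} {i : X₁ ⟶ X₂} {p : X₂ ⟶ X₃} {w : i ≫ p = 0}
    (h : (ShortComplex.mk i p w).ShortExact) (t : T ⟶ X₂) (ht : t ≫ p = 0) :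
    ∃ t' : T ⟶ X₁, t' ≫ i = t :=
  have : Mono (ShortComplex.mk i p w).f := h.mono_f
  ⟨h.exact.lift t ht, h.exact.lift_f t ht⟩

lemma ShortExact.exists_desc {X₁ X₂ X₃ T : 𝓒} {i : X₁ ⟶ X₂} {p : X₂ ⟶ X₃} {w : i ≫ p = 0}
    (h : (ShortComplex.mk i p w).ShortExact) (t : X₂ ⟶ T) (ht : i ≫ t = 0) :
    ∃ t' : X₃ ⟶ T, p ≫ t' = t :=
  have : Epi (ShortComplex.mk i p w).g := h.epi_g
  ⟨h.exact.desc t ht, h.exact.g_desc t ht⟩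

/-- A section of a short exact sequence yields a retraction. -/
lemma ShortExact.exists_retraction {X₁ X₂ X₃ : 𝓒} {i : X₁ ⟶ X₂} {p : X₂ ⟶ X₃} {w : i ≫ p = 0}
    (h : (ShortComplex.mk i p w).ShortExact) (hs : ∃ s : X₃ ⟶ X₂, s ≫ p = 𝟙 X₃) :
    ∃ r : X₂ ⟶ X₁, i ≫ r = 𝟙 X₁ := by
  obtain ⟨s, hs⟩ := hs
  exact ⟨_, (ShortComplex.Splitting.ofExactOfSection _ h.exact s hs h.mono_f).f_r⟩

/-- A retraction of a short exact sequence yields a section. -/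
lemma ShortExact.exists_section {X₁ X₂ X₃ : 𝓒} {i : X₁ ⟶ X₂} {p : X₂ ⟶ X₃} {w : i ≫ p = 0}
    (h : (ShortComplex.mk i p w).ShortExact) (hr : ∃ r : X₂ ⟶ X₁, i ≫ r = 𝟙 X₁) :
    ∃ s : X₃ ⟶ X₂, s ≫ p = 𝟙 X₃ := by
  obtain ⟨r, hr⟩ := hr
  exact ⟨_, (ShortComplex.Splitting.ofExactOfRetraction _ h.exact r hr h.epi_g).s_g⟩

/-- If extensions of `C` by the kernel of an epimorphism `p` split, then morphisms from `C`
lift along `p`. -/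
lemma ExtSplits.exists_lift {C Y M N : 𝓒} (hC : ExtSplits C Y) {i : Y ⟶ M} {p : M ⟶ N}
    {w : i ≫ p = 0} (h : (ShortComplex.mk i p w).ShortExact) (f : C ⟶ N) :
    ∃ g : C ⟶ M, g ≫ p = f := by
  have : Mono i := h.mono_f
  have : Epi p := h.epi_g
  obtain ⟨i', h₁, h₂⟩ : ∃ i' : Y ⟶ pullback p f, i' ≫ pullback.fst p f = i ∧
      i' ≫ pullback.snd p f = 0 :=
    ⟨pullback.lift i 0 (by rw [w, zero_comp]), pullback.lift_fst _ _ _, pullback.lift_snd _ _ _⟩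
  have : Mono i' := mono_of_mono_fac h₁
  obtain ⟨s, hs⟩ := hC i' (pullback.snd p f) h₂ (shortExact_mk_of_lift _ _ _ fun T t ht ↦ by
    obtain ⟨t', ht'⟩ := ShortExact.exists_lift h (t ≫ pullback.fst p f)
      (by rw [Category.assoc, pullback.condition, reassoc_of% ht, zero_comp])
    exact ⟨t', by apply pullback.hom_ext <;> simp [ht, ht', h₁, h₂]⟩)
  exact ⟨s ≫ pullback.fst p f, by rw [Category.assoc, pullback.condition, reassoc_of% hs]⟩

/-- If extensions of the cokernel of a monomorphism `i` by `Y` split, then morphisms to `Y`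
extend along `i`. -/
lemma ExtSplits.exists_extension {C Y K P : 𝓒} (hC : ExtSplits C Y) {i : K ⟶ P} {p : P ⟶ C}
    {w : i ≫ p = 0} (h : (ShortComplex.mk i p w).ShortExact) (f : K ⟶ Y) :
    ∃ g : P ⟶ Y, i ≫ g = f := by
  have : Mono i := h.mono_f
  have : Epi p := h.epi_g
  obtain ⟨p', h₁, h₂⟩ : ∃ p' : pushout i f ⟶ C, pushout.inl i f ≫ p' = p ∧
      pushout.inr i f ≫ p' = 0 :=
    ⟨pushout.desc p 0 (by rw [w, comp_zero]), pushout.inl_desc _ _ _, pushout.inr_desc _ _ _⟩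
  have : Epi p' := epi_of_epi_fac h₁
  have hE : (ShortComplex.mk (pushout.inr i f) p' h₂).ShortExact :=
    shortExact_mk_of_desc _ _ _ fun T t ht ↦ by
      obtain ⟨t', ht'⟩ := ShortExact.exists_desc h (pushout.inl i f ≫ t)
        (by rw [pushout.condition_assoc, ht, comp_zero])
      exact ⟨t', by apply pushout.hom_ext <;> simp [ht, ht', reassoc_of% h₁, reassoc_of% h₂]⟩
  obtain ⟨r, hr⟩ := ShortExact.exists_retraction hE (hC _ _ _ hE)
  exact ⟨pushout.inl i f ≫ r, by rw [pushout.condition_assoc, hr, Category.comp_id]⟩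

lemma ExtSplits.of_forall_lift {C Y M N : 𝓒} [Injective M] {i : Y ⟶ M} {p : M ⟶ N}
    {w : i ≫ p = 0} (h : (ShortComplex.mk i p w).ShortExact)
    (hl : ∀ f : C ⟶ N, ∃ g : C ⟶ M, g ≫ p = f) : ExtSplits C Y := by
  intro E j q wE hE
  have : Mono i := h.mono_f
  have : Mono j := hE.mono_f
  apply ShortExact.exists_section hE
  let e : E ⟶ M := Injective.factorThru i j
  have he : j ≫ e = i := Injective.comp_factorThru i j
  obtain ⟨f, hf⟩ := ShortExact.exists_desc hE (e ≫ p) (by rw [reassoc_of% he, w])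
  obtain ⟨g, hg⟩ := hl f
  obtain ⟨r, hr⟩ := ShortExact.exists_lift h (e - q ≫ g) (by simp [hg, hf])
  exact ⟨r, by rw [← cancel_mono i, Category.assoc, hr]; simp [he, reassoc_of% wE]⟩

lemma ExtSplits.of_forall_extension {C Y K P : 𝓒} [Projective P] {i : K ⟶ P} {p : P ⟶ C}
    {w : i ≫ p = 0} (h : (ShortComplex.mk i p w).ShortExact)
    (hl : ∀ f : K ⟶ Y, ∃ g : P ⟶ Y, i ≫ g = f) : ExtSplits C Y := by
  intro E j q wE hE
  have : Epi p := h.epi_g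
  have : Epi q := hE.epi_g
  let e : P ⟶ E := Projective.factorThru p q
  have he : e ≫ q = p := Projective.factorThru_comp p q
  obtain ⟨f, hf⟩ := ShortExact.exists_lift hE (i ≫ e) (by rw [Category.assoc, he, w])
  obtain ⟨g, hg⟩ := hl f
  obtain ⟨s, hs⟩ := ShortExact.exists_desc h (e - g ≫ j) (by simp [reassoc_of% hg, hf])
  exact ⟨s, by rw [← cancel_epi p, reassoc_of% hs]; simp [he, wE]⟩

lemma extSplits_of_injective {C J : 𝓒} [Injective J] : ExtSplits C J := fun _ i _ _ h ↦ by
  have : Mono i := h.mono_f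
  exact ShortExact.exists_section h ⟨Injective.factorThru (𝟙 J) i, Injective.comp_factorThru _ _⟩

lemma extSplits_of_projective {P Y : 𝓒} [Projective P] : ExtSplits P Y := fun _ _ p _ h ↦ by
  have : Epi p := h.epi_g
  exact ⟨Projective.factorThru (𝟙 P) p, Projective.factorThru_comp _ _⟩

lemma ExtSplits.of_iso_left {C C' Y : 𝓒} (e : C ≅ C') (h : ExtSplits C Y) : ExtSplits C' Y :=
  fun _ i p w hE ↦ by
    obtain ⟨g, hg⟩ := h.exists_lift hE e.hom
    exact ⟨e.inv ≫ g, by simp [hg]⟩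

lemma ExtSplits.of_iso_right {C Y Y' : 𝓒} (e : Y ≅ Y') (h : ExtSplits C Y) : ExtSplits C Y' :=
  fun E i p w hE ↦ by
    have : Mono i := hE.mono_f
    have : Epi p := hE.epi_g
    refine h (e.hom ≫ i) p (by simp [w]) (shortExact_mk_of_lift _ _ _ fun T t ht ↦ ?_)
    obtain ⟨t', ht'⟩ := ShortExact.exists_lift hE t ht
    exact ⟨t' ≫ e.inv, by simp [ht']⟩

lemma subsingleton_ext_iff_extSplits [EnoughInjectives 𝓒] [HasExt.{w} 𝓒] (C Y : 𝓒) :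
    Subsingleton (Ext C Y 1) ↔ ExtSplits C Y := by
  constructor
  · intro hs E i p wE hE
    obtain ⟨s, hs⟩ := Ext.covariant_sequence_exact₃ C hE (Ext.mk₀ (𝟙 C)) (zero_add 1)
      (Subsingleton.elim _ _)
    obtain ⟨s, rfl⟩ := Ext.mk₀_bijective _ _ |>.2 s
    exact ⟨s, (Ext.mk₀_bijective _ _).1 (by simpa using hs)⟩
  · intro h
    refine subsingleton_of_forall_eq 0 fun x ↦ ?_
    have hJ := shortExact_mk_cokernel (Injective.ι Y)
    obtain ⟨y, rfl⟩ := Ext.covariant_sequence_exact₁ C hJ x (Ext.eq_zero_of_injective _)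
      (zero_add 1)
    obtain ⟨y, rfl⟩ := Ext.mk₀_bijective _ _ |>.2 y
    obtain ⟨g, rfl⟩ := h.exists_lift hJ y
    rw [← Ext.mk₀_comp_mk₀, Ext.comp_assoc_of_second_deg_zero, hJ.comp_extClass, Ext.comp_zero]

end Abelian

section SmallObject

open MorphismProperty IsGrothendieckAbelian ZeroObject

variable {𝓒 : Type*} [Category* 𝓒] [Abelian 𝓒]

/-- Any small family of monomorphisms of a Grothendieck abelian category permits the small
object argument. -/
lemma hasSmallObjectArgument_ofHoms [IsGrothendieckAbelian.{w} 𝓒] {J : Type w} {A B : J → 𝓒}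
    (f : ∀ j, A j ⟶ B j) [∀ j, Mono (f j)] : HasSmallObjectArgument.{w} (ofHoms f) := by
  obtain ⟨κ, hκ', hκ⟩ :=
    HasCardinalLT.exists_regular_cardinal_forall.{w} (fun j ↦ Subobject (A j))
  have : Fact κ.IsRegular := ⟨hκ'⟩
  have : Nonempty κ.ord.ToType := by simpa using hκ'.ne_zero
  have := WellFoundedLT.toOrderBot κ.ord.ToType
  have hmono : ofHoms f ≤ monomorphisms 𝓒 := by
    rintro _ _ _ ⟨j⟩
    exact inferInstanceAs (Mono (f j))
  exact ⟨κ, inferInstance, inferInstance,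
    { preservesColimit {A B X Y} i hi g hg := by
        let hg' : (monomorphisms 𝓒).TransfiniteCompositionOfShape κ.ord.ToType g :=
          { toTransfiniteCompositionOfShape := hg.toTransfiniteCompositionOfShape
            map_mem j hj := by
              have := (hg.attachCells j hj).pushouts_coproducts
              simp only [ofHoms_homFamily] at this
              refine (?_ : _ ≤ monomorphisms 𝓒) _ this
              simpa only [pushouts_le_iff, coproducts_le_iff] using hmono }
        have (j j' : κ.ord.ToType) (φ : j ⟶ j') : Mono (hg'.F.map φ) := hg'.mem_map φ
        apply preservesColimit_coyoneda_obj_of_mono (Y := hg'.F) (κ := κ)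
        obtain ⟨j⟩ := hi
        exact hκ j }⟩

variable [EnoughProjectives 𝓒] {J : Type w} (S : J → 𝓒) (G : 𝓒)

/-- The arrows `Ω (S j) ⟶ P j`, where `P j` is a projective cover of `S j`, and `0 ⟶ G`. -/
noncomputable def generatingArrow : Option J → Arrow 𝓒
  | some j => Arrow.mk (kernel.ι (Projective.π (S j)))
  | none => Arrow.mk (0 : 0 ⟶ G)

instance (o : Option J) : Mono (generatingArrow S G o).hom :=
  match o with
  | some j => inferInstanceAs (Mono (kernel.ι (Projective.π (S j))))
  | none => inferInstanceAs (Mono (0 : 0 ⟶ G))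

/-- The morphism property consisting of the arrows `generatingArrow S G`. -/
noncomputable abbrev generating : MorphismProperty 𝓒 := ofHoms fun o ↦ (generatingArrow S G o).hom

variable {S G}

lemma epi_of_rlp_generating (hG : IsSeparator G) {E C : 𝓒} {p : E ⟶ C}
    (hp : (generating S G).rlp p) : Epi p := by
  have : HasLiftingProperty (0 : 0 ⟶ G) p :=
    hp _ (ofHoms.mk (f := fun o ↦ (generatingArrow S G o).hom) none)
  refine ⟨fun a b hab ↦ hG.def _ _ fun h ↦ ?_⟩
  have sq : CommSq (0 : 0 ⟶ E) (0 : 0 ⟶ G) p h := ⟨by simp⟩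
  rw [← sq.fac_right, Category.assoc, hab, Category.assoc]

lemma extSplits_of_rlp_generating {E C Y : 𝓒} {i : Y ⟶ E} {p : E ⟶ C} (w : i ≫ p = 0)
    (h : (ShortComplex.mk i p w).ShortExact) (hp : (generating S G).rlp p) (j : J) :
    ExtSplits (S j) Y := by
  refine .of_forall_extension (shortExact_mk_kernel (Projective.π (S j))) fun f ↦ ?_
  have : HasLiftingProperty (kernel.ι (Projective.π (S j))) p :=
    hp _ (ofHoms.mk (f := fun o ↦ (generatingArrow S G o).hom) (some j))
  have sq : CommSq (f ≫ i) (kernel.ι (Projective.π (S j))) p 0 := ⟨by simp [w]⟩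
  have : Mono i := h.mono_f
  obtain ⟨t, ht⟩ := ShortExact.exists_lift h sq.lift sq.fac_right
  exact ⟨t, by rw [← cancel_mono i, Category.assoc, ht, sq.fac_left]⟩

lemma rlp_generating [Projective G] {E C Y : 𝓒} {i : Y ⟶ E} {p : E ⟶ C} (w : i ≫ p = 0)
    (h : (ShortComplex.mk i p w).ShortExact) (hY : ∀ j, ExtSplits (S j) Y) :
    (generating S G).rlp p := by
  have : Epi p := h.epi_g
  rintro _ _ _ ⟨_ | j⟩
  · change HasLiftingProperty (0 : 0 ⟶ G) p
    exact ⟨fun {f g} sq ↦ ⟨⟨⟨Projective.factorThru g p, (isZero_zero 𝓒).eq_of_src _ _,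
      Projective.factorThru_comp _ _⟩⟩⟩⟩
  · change HasLiftingProperty (kernel.ι (Projective.π (S j))) p
    refine ⟨fun {f g} sq ↦ ?_⟩
    let g' := Projective.factorThru g p
    have hg' : g' ≫ p = g := Projective.factorThru_comp _ _
    obtain ⟨t, ht⟩ := ShortExact.exists_lift h (f - kernel.ι _ ≫ g') (by
      rw [Preadditive.sub_comp, sq.w, Category.assoc, hg', sub_self])
    obtain ⟨t', ht'⟩ := (hY j).exists_extension (shortExact_mk_kernel (Projective.π (S j))) t
    exact ⟨⟨⟨g' + t' ≫ i, by simp [reassoc_of% ht', ht], by simp [hg', w]⟩⟩⟩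

/-- In a Grothendieck abelian category with enough projectives and a projective separator, the
cotorsion pair generated by a small family of objects is complete. -/
theorem isComplete_of_family [IsGrothendieckAbelian.{w} 𝓒] [Projective G] (hG : IsSeparator G) :
    IsCompleteCotorsionPair {C : 𝓒 | ∀ Y, (∀ j, ExtSplits (S j) Y) → ExtSplits C Y}
      {Y | ∀ j, ExtSplits (S j) Y} := by
  have : HasSmallObjectArgument.{w} (generating S G) := hasSmallObjectArgument_ofHoms _
  intro Y
  constructor
  · let fac := factorizationData (generating S G).rlp.llp (generating S G).rlp (0 : 0 ⟶ Y)
    have : Epi fac.p := epi_of_rlp_generating hG fac.hp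
    refine ⟨kernel fac.p, fac.Z, kernel.ι _, fac.p, kernel.condition _, shortExact_mk_kernel _,
      fun D hD E i p w hE ↦ ?_,
      extSplits_of_rlp_generating _ (shortExact_mk_kernel fac.p) fac.hp⟩
    have : HasLiftingProperty fac.i p := fac.hi _ (rlp_generating (S := S) w hE hD)
    have sq : CommSq (0 : 0 ⟶ E) fac.i p (𝟙 _) := ⟨(isZero_zero 𝓒).eq_of_src _ _⟩
    exact ⟨sq.lift, sq.fac_right⟩
  · let fac := factorizationData (generating S G).rlp.llp (generating S G).rlp (0 : Y ⟶ 0)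
    have h₀ (E : 𝓒) : (ShortComplex.mk (𝟙 E) (0 : E ⟶ 0) (by simp)).ShortExact :=
      have : Epi (0 : E ⟶ 0) := ⟨fun _ _ _ ↦ (isZero_zero 𝓒).eq_of_src _ _⟩
      shortExact_mk_of_lift _ _ _ fun _ t _ ↦ ⟨t, by simp⟩
    have : Mono fac.i := by
      have : HasLiftingProperty fac.i (0 : Injective.under Y ⟶ 0) :=
        fac.hi _ (rlp_generating (S := S) _ (h₀ _) fun _ ↦ extSplits_of_injective)
      have sq : CommSq (Injective.ι Y) fac.i (0 : Injective.under Y ⟶ 0) 0 := ⟨by simp⟩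
      exact mono_of_mono_fac sq.fac_left
    refine ⟨fac.Z, cokernel fac.i, fac.i, cokernel.π _, cokernel.condition _,
      shortExact_mk_cokernel _, fun D hD E i p w hE ↦ ?_,
      extSplits_of_rlp_generating (G := G) _ (h₀ _) ?_⟩
    · have : HasLiftingProperty fac.i p := fac.hi _ (rlp_generating (S := S) w hE hD)
      have sq : CommSq (0 : Y ⟶ E) fac.i p (cokernel.π fac.i) := ⟨by simp⟩
      refine ⟨cokernel.desc fac.i sq.lift sq.fac_left, ?_⟩
      rw [← cancel_epi (cokernel.π fac.i), cokernel.π_desc_assoc, sq.fac_right, Category.comp_id]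
    · simpa only [(isZero_zero 𝓒).eq_of_tgt fac.p 0] using fac.hp

end SmallObject

section FreeComplex

variable {R : Type u} [Ring R] {ι : Type} {c : ComplexShape ι}

/-- The element `d x` of a complex of modules. -/
abbrev del (X : HomologicalComplex (ModuleCat.{u} R) c) (i j : ι) : X.X i →ₗ[R] X.X j :=
  (X.d i j).hom

lemma del_del (X : HomologicalComplex (ModuleCat.{u} R) c) (i j k : ι) (x : X.X i) :
    del X j k (del X i j x) = 0 :=
  congr($(X.d_comp_d i j k) x)

lemma f_del {X Y : HomologicalComplex (ModuleCat.{u} R) c} (f : X ⟶ Y) (i j : ι) (x : X.X i) :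
    (f.f j).hom (del X i j x) = del Y i j ((f.f i).hom x) :=
  congr($(f.comm i j) x).symm

/-- Build a complex of modules from linear maps. -/
@[simps]
def mkComplex (c : ComplexShape ι) (M : ι → Type u) [∀ i, AddCommGroup (M i)] [∀ i, Module R (M i)]
    (d : ∀ i j, M i →ₗ[R] M j) (shape : ∀ i j, ¬ c.Rel i j → d i j = 0)
    (dd : ∀ i j k, c.Rel i j → c.Rel j k → d j k ∘ₗ d i j = 0) :
    HomologicalComplex (ModuleCat.{u} R) c where
  X i := ModuleCat.of R (M i)
  d i j := ModuleCat.ofHom (d i j)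
  shape i j h := by rw [shape i j h]; rfl
  d_comp_d' i j k h h' := by rw [← ModuleCat.ofHom_comp, dd i j k h h']; rfl

/-- Build a morphism of complexes of modules from linear maps. -/
@[simps]
def mkHom {X Y : HomologicalComplex (ModuleCat.{u} R) c} (f : ∀ i, X.X i →ₗ[R] Y.X i)
    (hf : ∀ i j, c.Rel i j → ∀ x, f j (del X i j x) = del Y i j (f i x)) : X ⟶ Y where
  f i := ModuleCat.ofHom (f i)
  comm' i j h := by
    ext x
    exact (hf i j h x).symm

/-- The components of the free complex on a graded family of generators. -/
abbrev FreeModule (R : Type u) [Ring R] (c : ComplexShape ι) (K : ι → Type u) (q : ι) : Type u :=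
  (K q →₀ R) × ((Σ p : {p // c.Rel p q}, K p) →₀ R)

open Classical in
/-- The differentials of the free complex on a graded family of generators. -/
noncomputable def freeDel (R : Type u) [Ring R] (c : ComplexShape ι) (K : ι → Type u) (i j : ι) :
    FreeModule R c K i →ₗ[R] FreeModule R c K j :=
  if h : c.Rel i j then
    LinearMap.inr R _ _ ∘ₗ Finsupp.lmapDomain R R (fun x ↦ ⟨⟨i, h⟩, x⟩) ∘ₗ LinearMap.fst R _ _
  else 0

/-- The free complex on a graded family of generators. -/
noncomputable def freeComplex (R : Type u) [Ring R] (c : ComplexShape ι) (K : ι → Type u) :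
    HomologicalComplex (ModuleCat.{u} R) c :=
  mkComplex c (FreeModule R c K) (freeDel R c K) (fun i j h ↦ dif_neg h)
    (fun i j k h h' ↦ by
      rw [freeDel, freeDel, dif_pos h, dif_pos h']
      ext x <;> simp)

/-- The generators of the free complex. -/
noncomputable def freeComplex.gen {K : ι → Type u} (q : ι) (x : K q) : (freeComplex R c K).X q :=
  ((Finsupp.single x 1, 0) : FreeModule R c K q)

lemma freeComplex.del_gen {K : ι → Type u} {i j : ι} (h : c.Rel i j) (x : K i) :
    del (freeComplex R c K) i j (gen i x) =
      ((0, Finsupp.single ⟨⟨i, h⟩, x⟩ 1) : FreeModule R c K j) := by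
  change freeDel R c K i j (Finsupp.single x 1, 0) = _
  simp [freeDel, dif_pos h]

lemma freeComplex.exists_hom {K : ι → Type u} (Y : HomologicalComplex (ModuleCat.{u} R) c)
    (y : ∀ q, K q → Y.X q) :
    ∃ f : freeComplex R c K ⟶ Y, ∀ q x, (f.f q).hom (gen q x) = y q x := by
  let φ (q : ι) : FreeModule R c K q →ₗ[R] Y.X q :=
    LinearMap.coprod (Finsupp.linearCombination R (y q))
      (Finsupp.linearCombination R fun z : Σ p : {p // c.Rel p q}, K p ↦ del Y z.1 q (y z.1 z.2))
  have hφ (i j : ι) (h : c.Rel i j) : φ j ∘ₗ freeDel R c K i j = del Y i j ∘ₗ φ i := by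
    ext x
    · simp [φ, freeDel, dif_pos h]
    · simp [φ, freeDel, dif_pos h, del_del]
  refine ⟨mkHom φ fun i j h x ↦ DFunLike.congr_fun (hφ i j h) x, fun q x ↦ ?_⟩
  change φ q (Finsupp.single x 1, 0) = _
  simp [φ]

lemma freeComplex.hom_ext {K : ι → Type u} {Y : HomologicalComplex (ModuleCat.{u} R) c}
    {f g : freeComplex R c K ⟶ Y}
    (h : ∀ q x, (f.f q).hom (gen q x) = (g.f q).hom (gen q x)) : f = g := by
  ext q : 2
  have hq (f' g' : FreeModule R c K q →ₗ[R] Y.X q) (hfg : ∀ x, f' (Finsupp.single x 1, 0) =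
      g' (Finsupp.single x 1, 0)) (hfg' : ∀ z, f' (0, Finsupp.single z 1) =
      g' (0, Finsupp.single z 1)) : f' = g' := by
    ext x
    · simpa using hfg x
    · simpa using hfg' x
  refine hq _ _ (h q) fun ⟨⟨i, hi⟩, x⟩ ↦ ?_
  have := congr(del Y i q $(h i x))
  rw [← f_del, ← f_del, del_gen hi] at this
  exact this

lemma surjective_of_epi {X Y : HomologicalComplex (ModuleCat.{u} R) c} (f : X ⟶ Y) [Epi f] (q : ι) :
    Function.Surjective (f.f q).hom :=
  (ModuleCat.epi_iff_surjective _).1 inferInstance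

lemma injective_of_mono {X Y : HomologicalComplex (ModuleCat.{u} R) c} (f : X ⟶ Y) [Mono f]
    (q : ι) :
    Function.Injective (f.f q).hom :=
  (ModuleCat.mono_iff_injective _).1 inferInstance

lemma epi_of_surjective {X Y : HomologicalComplex (ModuleCat.{u} R) c} (f : X ⟶ Y)
    (h : ∀ q, Function.Surjective (f.f q).hom) : Epi f :=
  have (q : ι) : Epi (f.f q) := (ModuleCat.epi_iff_surjective _).2 (h q)
  HomologicalComplex.epi_of_epi_f f inferInstance

lemma mono_of_injective {X Y : HomologicalComplex (ModuleCat.{u} R) c} (f : X ⟶ Y)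
    (h : ∀ q, Function.Injective (f.f q).hom) : Mono f :=
  have (q : ι) : Mono (f.f q) := (ModuleCat.mono_iff_injective _).2 (h q)
  HomologicalComplex.mono_of_mono_f f inferInstance

instance (K : ι → Type u) : Projective (freeComplex R c K) where
  factors f e _ := by
    choose y hy using fun q (x : K q) ↦ surjective_of_epi e q ((f.f q).hom (freeComplex.gen q x))
    obtain ⟨g, hg⟩ := freeComplex.exists_hom _ y
    exact ⟨g, freeComplex.hom_ext fun q x ↦ by simp [hg, hy]⟩

lemma isSeparator_freeComplex :
    IsSeparator (freeComplex R c fun _ ↦ PUnit) := by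
  refine isSeparator_def _ |>.2 fun X Y f g h ↦ ?_
  ext q x
  obtain ⟨t, ht⟩ := freeComplex.exists_hom (K := fun _ ↦ PUnit) X (fun p _ ↦ by
    classical exact if hp : q = p then hp ▸ x else 0)
  have := congr(($(h t).f q).hom (freeComplex.gen q ⟨⟩))
  simpa [ht] using this

instance : EnoughProjectives (HomologicalComplex (ModuleCat.{u} R) c) where
  presentation X := by
    obtain ⟨f, hf⟩ := freeComplex.exists_hom (K := fun q ↦ X.X q) X (fun _ ↦ id)
    have := epi_of_surjective f fun q x ↦ ⟨_, hf q x⟩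
    exact ⟨⟨_, f⟩⟩

instance : IsGrothendieckAbelian.{u} (HomologicalComplex (ModuleCat.{u} R) c) where
  hasSeparator := ⟨_, isSeparator_freeComplex⟩

end FreeComplex

section Modules

variable {R : Type u} [Ring R]

/-- A morphism from a finitely presented module to a quotient module is described by a finite
system of linear equations. -/
lemma exists_system {M : Type u} [AddCommGroup M] [Module R M] (V : Submodule R M) (F : Type u)
    [AddCommGroup F] [Module R F] [Module.FinitePresentation R F] (g : F →ₗ[R] M ⧸ V) :
    ∃ (n m : ℕ) (A : Fin n → Fin m → R) (x : Fin m → M), (∀ i, ∑ j, A i j • x j ∈ V) ∧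
      ∀ (V' : Submodule R M) (hV : V' ≤ V) (x' : Fin m → M), (∀ j, x' j - x j ∈ V) →
        (∀ i, ∑ j, A i j • x' j ∈ V') → ∃ h : F →ₗ[R] M ⧸ V', Submodule.factor hV ∘ₗ h = g := by
  obtain ⟨m, K, e, hK⟩ := Module.FinitePresentation.exists_fin R F
  obtain ⟨n, A, hA⟩ := Submodule.fg_iff_exists_fin_generating_family.1 hK
  let b (j : Fin m) : Fin m → R := Pi.single j 1
  choose x hx using fun j ↦ V.mkQ_surjective (g (e.symm (K.mkQ (b j))))
  have hb (y : Fin m → R) : y = ∑ j, y j • b j := by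
    ext i
    simp [b, Finset.sum_apply, Pi.single_apply]
  refine ⟨n, m, A, x, fun i ↦ ?_, fun V' hV x' hx' hA' ↦ ?_⟩
  · have h₁ : K.mkQ (A i) = 0 :=
      (Submodule.Quotient.mk_eq_zero K).2 (hA ▸ Submodule.subset_span (Set.mem_range_self i))
    rw [← V.ker_mkQ, LinearMap.mem_ker, map_sum]
    simp_rw [map_smul, hx, ← map_smul]
    rw [← map_sum, ← map_sum, ← map_sum, ← hb, h₁, map_zero, map_zero]
  · let φ : (Fin m → R) →ₗ[R] M ⧸ V' := Fintype.linearCombination R fun j ↦ V'.mkQ (x' j)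
    have hφ : K ≤ LinearMap.ker φ := by
      rw [← hA, Submodule.span_le]
      rintro _ ⟨i, rfl⟩
      have : V'.mkQ (∑ j, A i j • x' j) = 0 :=
        (Submodule.Quotient.mk_eq_zero V').2 (hA' i)
      simpa [φ, Fintype.linearCombination_apply] using this
    refine ⟨K.liftQ φ hφ ∘ₗ e.toLinearMap, ?_⟩
    have : (Submodule.factor hV ∘ₗ K.liftQ φ hφ) = g ∘ₗ e.symm.toLinearMap := by
      ext j
      have : V.mkQ (x' j) = V.mkQ (x j) := (Submodule.Quotient.eq V).2 (hx' j)
      simpa [φ, b] using this.trans (hx j)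
    ext y
    simpa using DFunLike.congr_fun this (e y)

variable {𝓐 𝓑 : Set (ModuleCat.{u} R)}

variable (𝓐 𝓑) in
/-- A cotorsion pair of modules, expressed by splittings of extensions, whose left class is
closed under kernels of epimorphisms and pure quotients. -/
structure IsPureCotorsionPair : Prop where
  mem_left_iff (A : ModuleCat.{u} R) : A ∈ 𝓐 ↔ ∀ B ∈ 𝓑, ExtSplits A B
  mem_right_iff (B : ModuleCat.{u} R) : B ∈ 𝓑 ↔ ∀ A ∈ 𝓐, ExtSplits A B
  kernel_mem : ClosedUnderKernelsOfEpis 𝓐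
  pure_mem : ClosedUnderPureQuotients R 𝓐

namespace IsPureCotorsionPair

variable (h𝓐 : IsPureCotorsionPair 𝓐 𝓑)

include h𝓐

lemma left_of_iso {A A' : ModuleCat.{u} R} (e : A ≅ A') (hA : A ∈ 𝓐) : A' ∈ 𝓐 :=
  (h𝓐.mem_left_iff _).2 fun B hB ↦ ((h𝓐.mem_left_iff _).1 hA B hB).of_iso_left e

lemma right_of_iso {B B' : ModuleCat.{u} R} (e : B ≅ B') (hB : B ∈ 𝓑) : B' ∈ 𝓑 :=
  (h𝓐.mem_right_iff _).2 fun A hA ↦ ((h𝓐.mem_right_iff _).1 hB A hA).of_iso_right e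

lemma left_of_projective (P : ModuleCat.{u} R) [Projective P] : P ∈ 𝓐 :=
  (h𝓐.mem_left_iff _).2 fun _ _ ↦ extSplits_of_projective

lemma right_of_injective (J : ModuleCat.{u} R) [Injective J] : J ∈ 𝓑 :=
  (h𝓐.mem_right_iff _).2 fun _ _ ↦ extSplits_of_injective

lemma coproduct_mem {I : Type u} (A : I → ModuleCat.{u} R) (hA : ∀ i, A i ∈ 𝓐) : ∐ A ∈ 𝓐 := by
  refine (h𝓐.mem_left_iff _).2 fun B hB ↦
    .of_forall_lift (shortExact_mk_cokernel (Injective.ι B)) fun f ↦ ?_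
  choose g hg using fun i ↦ ((h𝓐.mem_left_iff _).1 (hA i) B hB).exists_lift
    (shortExact_mk_cokernel (Injective.ι B)) (Sigma.ι A i ≫ f)
  exact ⟨Sigma.desc g, Sigma.hom_ext _ _ fun i ↦ by simp [hg]⟩

lemma pure_quotient_mem {M : Type u} [AddCommGroup M] [Module R M] {V' V : Submodule R M}
    (hV : V' ≤ V) (hM : ModuleCat.of R (M ⧸ V') ∈ 𝓐)
    (H : ∀ (n m : ℕ) (A : Fin n → Fin m → R) (x : Fin m → M), (∀ i, ∑ j, A i j • x j ∈ V) →
      ∃ x' : Fin m → M, (∀ j, x' j - x j ∈ V) ∧ ∀ i, ∑ j, A i j • x' j ∈ V') :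
    ModuleCat.of R (M ⧸ V) ∈ 𝓐 := by
  let p : ModuleCat.of R (M ⧸ V') ⟶ ModuleCat.of R (M ⧸ V) := ModuleCat.ofHom (Submodule.factor hV)
  have : Epi p := (ModuleCat.epi_iff_surjective _).2 (Submodule.factor_surjective hV)
  refine h𝓐.pure_mem _ _ _ _ p _ (shortExact_mk_kernel p) (fun F hF g ↦ ?_) hM
  obtain ⟨n, m, A, x, hx, h⟩ := exists_system V F g.hom
  obtain ⟨x', hx', h'⟩ := H n m A x hx
  obtain ⟨l, hl⟩ := h V' hV x' hx' h'
  exact ⟨ModuleCat.ofHom l, ModuleCat.hom_ext hl⟩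

lemma quotient_iSup_mem {M : Type u} [AddCommGroup M] [Module R M] {I : Type u} [Nonempty I]
    (V : I → Submodule R M) (hV : Directed (· ≤ ·) V)
    (hM : ∀ i, ModuleCat.of R (M ⧸ V i) ∈ 𝓐) : ModuleCat.of R (M ⧸ ⨆ i, V i) ∈ 𝓐 := by
  let q (i : I) : ModuleCat.of R (M ⧸ V i) ⟶ ModuleCat.of R (M ⧸ ⨆ i, V i) :=
    ModuleCat.ofHom (Submodule.factor (le_iSup V i))
  let p : (∐ fun i ↦ ModuleCat.of R (M ⧸ V i)) ⟶ ModuleCat.of R (M ⧸ ⨆ i, V i) := Sigma.desc q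
  have hq (i : I) : Epi (q i) :=
    (ModuleCat.epi_iff_surjective _).2 (Submodule.factor_surjective (le_iSup V i))
  have : Epi p := epi_of_epi_fac (Sigma.ι_desc q (Classical.arbitrary I))
  refine h𝓐.pure_mem _ _ _ _ p _ (shortExact_mk_kernel p) (fun F hF g ↦ ?_)
    (h𝓐.coproduct_mem _ hM)
  obtain ⟨n, m, A, x, hx, h⟩ := exists_system (⨆ i, V i) F g.hom
  choose k hk using fun i ↦ (Submodule.mem_iSup_of_directed V hV).1 (hx i)
  obtain ⟨k₀, hk₀⟩ := hV.finite_le k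
  obtain ⟨l, hl⟩ := h (V k₀) (le_iSup V k₀) x (by simp) fun i ↦ hk₀ i (hk i)
  refine ⟨ModuleCat.ofHom l ≫ Sigma.ι (fun i ↦ ModuleCat.of R (M ⧸ V i)) k₀, ?_⟩
  rw [Category.assoc, Sigma.ι_desc]
  exact ModuleCat.hom_ext hl

lemma ker_mem {M N : Type u} [AddCommGroup M] [Module R M] [AddCommGroup N] [Module R N]
    (f : M →ₗ[R] N) (hf : Function.Surjective f) (hM : ModuleCat.of R M ∈ 𝓐)
    (hN : ModuleCat.of R N ∈ 𝓐) : ModuleCat.of R (LinearMap.ker f) ∈ 𝓐 :=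
  h𝓐.left_of_iso (ModuleCat.kernelIsoKer (ModuleCat.ofHom f))
    (h𝓐.kernel_mem _ ((ModuleCat.epi_iff_surjective _).2 hf) hM hN)

lemma left_of_equiv {M N : Type u} [AddCommGroup M] [Module R M] [AddCommGroup N] [Module R N]
    (e : M ≃ₗ[R] N) (hM : ModuleCat.of R M ∈ 𝓐) : ModuleCat.of R N ∈ 𝓐 :=
  h𝓐.left_of_iso e.toModuleIso hM

end IsPureCotorsionPair

end Modules

section Subcomplexes

variable {R : Type u} [Ring R] {ι : Type} {c : ComplexShape ι}

lemma shortExact_of_degreewise {X Y Z : HomologicalComplex (ModuleCat.{u} R) c} (i : X ⟶ Y)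
    (p : Y ⟶ Z) (w : i ≫ p = 0) (hi : ∀ q, Function.Injective (i.f q).hom)
    (hp : ∀ q, Function.Surjective (p.f q).hom)
    (hip : ∀ q y, (p.f q).hom y = 0 → ∃ x, (i.f q).hom x = y) :
    (ShortComplex.mk i p w).ShortExact := by
  have := mono_of_injective i hi
  have := epi_of_surjective p hp
  have hex : (ShortComplex.mk i p w).Exact :=
    HomologicalComplex.exact_of_degreewise_exact _ fun q ↦
      (ShortComplex.moduleCat_exact_iff _).2 (hip q)
  exact { exact := hex }

lemma exists_eq_of_shortExact {X Y Z : HomologicalComplex (ModuleCat.{u} R) c} {i : X ⟶ Y}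
    {p : Y ⟶ Z} {w : i ≫ p = 0} (h : (ShortComplex.mk i p w).ShortExact) (q : ι) (y : Y.X q)
    (hy : (p.f q).hom y = 0) : ∃ x, (i.f q).hom x = y :=
  (ShortComplex.moduleCat_exact_iff _).1
    (h.exact.map (HomologicalComplex.eval _ c q)) y hy

lemma comp_apply_eq_zero {X Y Z : HomologicalComplex (ModuleCat.{u} R) c} {i : X ⟶ Y}
    {p : Y ⟶ Z} (w : i ≫ p = 0) (q : ι) (x : X.X q) : (p.f q).hom ((i.f q).hom x) = 0 :=
  congr((($w).f q).hom x)

lemma comp_apply_eq_self {X Y : HomologicalComplex (ModuleCat.{u} R) c} {i : X ⟶ Y}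
    {p : Y ⟶ X} (w : i ≫ p = 𝟙 X) (q : ι) (x : X.X q) : (p.f q).hom ((i.f q).hom x) = x :=
  congr((($w).f q).hom x)

variable (X : HomologicalComplex (ModuleCat.{u} R) c)

/-- A graded submodule of a complex is stable if it is preserved by the differential. -/
def Stable (U : ∀ q, Submodule R (X.X q)) : Prop :=
  ∀ i j x, x ∈ U i → del X i j x ∈ U j

variable {X}

lemma Stable.sup {U V : ∀ q, Submodule R (X.X q)} (hU : Stable X U) (hV : Stable X V) :
    Stable X (U ⊔ V) := fun i j x hx ↦ by
  obtain ⟨a, ha, b, hb, rfl⟩ := Submodule.mem_sup.1 hx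
  rw [map_add]
  exact Submodule.add_mem_sup (hU i j a ha) (hV i j b hb)

lemma Stable.iSup {I : Type u} [Nonempty I] {U : I → ∀ q, Submodule R (X.X q)}
    (hd : Directed (· ≤ ·) U) (hU : ∀ i, Stable X (U i)) : Stable X (⨆ i, U i) := fun i j x hx ↦ by
  rw [iSup_apply, Submodule.mem_iSup_of_directed _ fun a b ↦ by
    obtain ⟨e, ha, hb⟩ := hd a b
    exact ⟨e, ha _, hb _⟩] at hx
  obtain ⟨a, ha⟩ := hx
  rw [iSup_apply]
  exact Submodule.mem_iSup_of_mem a (hU a i j x ha)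

lemma stable_range {Y : HomologicalComplex (ModuleCat.{u} R) c} (f : Y ⟶ X) :
    Stable X fun q ↦ LinearMap.range (f.f q).hom := by
  rintro i j _ ⟨y, rfl⟩
  exact ⟨del Y i j y, f_del f i j y⟩

lemma del_eq_zero {i j : ι} (h : ¬ c.Rel i j) : del X i j = 0 := by
  rw [del, X.shape i j h]
  rfl

/-- The quotient of a complex by a stable graded submodule. -/
def quo (X : HomologicalComplex (ModuleCat.{u} R) c) (U : ∀ q, Submodule R (X.X q))
    (hU : Stable X U) : HomologicalComplex (ModuleCat.{u} R) c :=
  mkComplex c (fun q ↦ X.X q ⧸ U q) (fun i j ↦ (U i).mapQ (U j) (del X i j) (hU i j))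
    (fun i j h ↦ by
      ext x
      simp [del_eq_zero h])
    (fun i j k _ _ ↦ by
      ext x
      simp [del_del])

/-- The subcomplex given by a stable graded submodule. -/
def sub (X : HomologicalComplex (ModuleCat.{u} R) c) (U : ∀ q, Submodule R (X.X q))
    (hU : Stable X U) : HomologicalComplex (ModuleCat.{u} R) c :=
  mkComplex c (fun q ↦ U q) (fun i j ↦ (del X i j).restrict (hU i j))
    (fun i j h ↦ by
      ext x
      simp [del_eq_zero h])
    (fun i j k _ _ ↦ by
      ext x
      simp [del_del])

/-- The projection onto a quotient complex. -/
def quoMk {U : ∀ q, Submodule R (X.X q)} (hU : Stable X U) : X ⟶ quo X U hU :=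
  mkHom (fun q ↦ (U q).mkQ) fun _ _ _ _ ↦ rfl

lemma quoMk_surjective {U : ∀ q, Submodule R (X.X q)} (hU : Stable X U) (q : ι) :
    Function.Surjective ((quoMk hU).f q).hom :=
  (U q).mkQ_surjective

lemma quoMk_eq_zero {U : ∀ q, Submodule R (X.X q)} (hU : Stable X U) {q : ι} {x : X.X q} :
    ((quoMk hU).f q).hom x = 0 ↔ x ∈ U q :=
  Submodule.Quotient.mk_eq_zero _

/-- The inclusion of a subcomplex. -/
def subι {U : ∀ q, Submodule R (X.X q)} (hU : Stable X U) : sub X U hU ⟶ X :=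
  mkHom (fun q ↦ (U q).subtype) fun _ _ _ _ ↦ rfl

lemma subι_injective {U : ∀ q, Submodule R (X.X q)} (hU : Stable X U) (q : ι) :
    Function.Injective ((subι hU).f q).hom :=
  (U q).subtype_injective

lemma exists_subι_eq {U : ∀ q, Submodule R (X.X q)} (hU : Stable X U) {q : ι} {x : X.X q} :
    (∃ y, ((subι hU).f q).hom y = x) ↔ x ∈ U q :=
  ⟨fun ⟨y, hy⟩ ↦ hy ▸ Subtype.property (p := (· ∈ U q)) y, fun hx ↦ ⟨⟨x, hx⟩, rfl⟩⟩

lemma exists_quo_desc {U : ∀ q, Submodule R (X.X q)} (hU : Stable X U)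
    {A : HomologicalComplex (ModuleCat.{u} R) c} (f : X ⟶ A)
    (hf : ∀ q x, x ∈ U q → (f.f q).hom x = 0) : ∃ g : quo X U hU ⟶ A, quoMk hU ≫ g = f :=
  ⟨mkHom (fun q ↦ (U q).liftQ (f.f q).hom (hf q)) fun i j _ x ↦ by
    obtain ⟨x, rfl⟩ := quoMk_surjective hU i x
    exact f_del f i j x, rfl⟩

lemma nonempty_quo_iso {U : ∀ q, Submodule R (X.X q)} (hU : Stable X U)
    {A : HomologicalComplex (ModuleCat.{u} R) c} (f : X ⟶ A)
    (hf : ∀ q, Function.Surjective (f.f q).hom) (hfU : ∀ q x, (f.f q).hom x = 0 ↔ x ∈ U q) :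
    Nonempty (A ≅ quo X U hU) := by
  obtain ⟨g, hg⟩ := exists_quo_desc hU f fun q x hx ↦ (hfU q x).2 hx
  have hg' (q x) : (g.f q).hom (((quoMk hU).f q).hom x) = (f.f q).hom x := congr((($hg).f q).hom x)
  have := epi_of_surjective g fun q a ↦ by
    obtain ⟨x, rfl⟩ := hf q a
    exact ⟨_, hg' q x⟩
  have := mono_of_injective g fun q ↦ by
    rw [injective_iff_map_eq_zero]
    intro x hx
    obtain ⟨x, rfl⟩ := quoMk_surjective hU q x
    rwa [quoMk_eq_zero, ← hfU, ← hg']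
  have := isIso_of_mono_of_epi g
  exact ⟨(asIso g).symm⟩

end Subcomplexes

section Deconstruction

variable {R : Type u} [Ring R] {ι : Type} {c : ComplexShape ι}

/-- The quotient of `E` by `U` is defined and belongs to `F`. -/
def QuoMem (F : Set (HomologicalComplex (ModuleCat.{u} R) c))
    (E : HomologicalComplex (ModuleCat.{u} R) c) (U : ∀ q, Submodule R (E.X q)) : Prop :=
  ∃ hU : Stable E U, quo E U hU ∈ F

/-- A complex is `T`-small if its components are images of the types `T q₀ q` for some `q₀`. -/
def IsSmall (T : ι → ι → Type u) (S : HomologicalComplex (ModuleCat.{u} R) c) : Prop :=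
  ∃ q₀, ∀ q, ∃ f : T q₀ q → S.X q, Function.Surjective f

/-- A class of complexes which is closed under isomorphisms, which has enough `T`-small
subobjects, and whose quotients are compatible with directed unions. -/
structure IsDeconstructible (T : ι → ι → Type u)
    (F : Set (HomologicalComplex (ModuleCat.{u} R) c)) : Prop where
  of_iso {X Y : HomologicalComplex (ModuleCat.{u} R) c} (e : X ≅ Y) : X ∈ F → Y ∈ F
  exists_small (X) (_ : X ∈ F) (q₀ : ι) (x : X.X q₀) :
    ∃ (Z : ∀ q, Submodule R (X.X q)) (hZ : Stable X Z), x ∈ Z q₀ ∧ IsSmall T (sub X Z hZ) ∧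
      sub X Z hZ ∈ F ∧ QuoMem F X Z
  iSup_mem (X) {I : Type u} [Nonempty I] (U : I → ∀ q, Submodule R (X.X q)) :
    Directed (· ≤ ·) U → (∀ i, QuoMem F X (U i)) → QuoMem F X (⨆ i, U i)

variable {T : ι → ι → Type u} {F : Set (HomologicalComplex (ModuleCat.{u} R) c)}

lemma shortExact_quo {Y E : HomologicalComplex (ModuleCat.{u} R) c} {i : Y ⟶ E}
    (hi : ∀ q, Function.Injective (i.f q).hom) {W V : ∀ q, Submodule R (E.X q)}
    (hW : Stable E W) (hV : Stable E V)
    (hWi : ∀ q y, (i.f q).hom y ∈ W q → (i.f q).hom y = 0)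
    (hVi : ∀ q x, x ∈ V q ↔ ∃ y, x - (i.f q).hom y ∈ W q)
    {g : quo E W hW ⟶ quo E V hV} (hg : quoMk hW ≫ g = quoMk hV) :
    ∃ w : (i ≫ quoMk hW) ≫ g = 0, (ShortComplex.mk (i ≫ quoMk hW) g w).ShortExact := by
  have hg' (q x) : (g.f q).hom (((quoMk hW).f q).hom x) = ((quoMk hV).f q).hom x :=
    congr((($hg).f q).hom x)
  have w : (i ≫ quoMk hW) ≫ g = 0 := by
    rw [Category.assoc, hg]
    ext q y
    have : (i.f q).hom y - (i.f q).hom y ∈ W q := by simp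
    exact (quoMk_eq_zero hV).2 ((hVi _ _).2 ⟨y, this⟩)
  refine ⟨w, shortExact_of_degreewise _ _ _ (fun q ↦ ?_) (fun q z ↦ ?_) fun q z hz ↦ ?_⟩
  · rw [injective_iff_map_eq_zero]
    intro y hy
    exact (injective_iff_map_eq_zero _).1 (hi q) _ (hWi q y ((quoMk_eq_zero hW).1 hy))
  · obtain ⟨x, rfl⟩ := quoMk_surjective hV q z
    exact ⟨_, hg' q x⟩
  · obtain ⟨x, rfl⟩ := quoMk_surjective hW q z
    rw [hg', quoMk_eq_zero, hVi] at hz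
    obtain ⟨y, hy⟩ := hz
    refine ⟨y, ?_⟩
    rw [← quoMk_eq_zero hW, map_sub, sub_eq_zero] at hy
    exact hy.symm

/-- If extensions of the small members of a deconstructible class by `Y` split, then so do
extensions of arbitrary members of the class by `Y`. -/
theorem IsDeconstructible.extSplits (hF : IsDeconstructible T F)
    {Y : HomologicalComplex (ModuleCat.{u} R) c}
    (hY : ∀ S ∈ F, IsSmall T S → ExtSplits S Y) {X : HomologicalComplex (ModuleCat.{u} R) c}
    (hX : X ∈ F) : ExtSplits X Y := by
  intro E i p w hE
  have : Mono i := hE.mono_f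
  have : Epi p := hE.epi_g
  have hi := injective_of_mono i
  let I (q : ι) : Submodule R (E.X q) := LinearMap.range (i.f q).hom
  let 𝒮 : Set (∀ q, Submodule R (E.X q)) :=
    {W | Stable E W ∧ (∀ q y, (i.f q).hom y ∈ W q → (i.f q).hom y = 0) ∧ QuoMem F E (W ⊔ I)}
  have hbot : ⊥ ∈ 𝒮 := by
    refine ⟨fun i j x hx ↦ ?_, fun q y hy ↦ hy, ?_⟩
    · obtain rfl : x = 0 := hx
      simp
    · rw [bot_sup_eq]
      obtain ⟨e⟩ := nonempty_quo_iso (stable_range i) p (surjective_of_epi p) fun q x ↦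
        ⟨exists_eq_of_shortExact hE q x, by
          rintro ⟨y, rfl⟩
          exact comp_apply_eq_zero w q y⟩
      exact ⟨stable_range i, hF.of_iso e hX⟩
  obtain ⟨W, -, ⟨⟨hW, hWi, hV, hWF⟩, hmax⟩⟩ := zorn_le_nonempty₀ 𝒮 (fun s hs hchain W₀ hW₀ ↦ by
    have : Nonempty s := ⟨⟨W₀, hW₀⟩⟩
    have hd : Directed (· ≤ ·) fun W : s ↦ (W : ∀ q, Submodule R (E.X q)) :=
      hchain.directedOn.directed_val
    have hd' (q : ι) : Directed (· ≤ ·) fun W : s ↦ (W : ∀ q, Submodule R (E.X q)) q :=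
      fun a b ↦ by
        obtain ⟨e, ha, hb⟩ := hd a b
        exact ⟨e, ha q, hb q⟩
    refine ⟨⨆ W : s, W, ⟨.iSup hd fun W ↦ (hs W.2).1, fun q y hy ↦ ?_, ?_⟩,
      fun W hWs ↦ le_iSup (fun W : s ↦ (W : ∀ q, Submodule R (E.X q))) ⟨W, hWs⟩⟩
    · rw [iSup_apply, Submodule.mem_iSup_of_directed _ (hd' q)] at hy
      obtain ⟨W, hW⟩ := hy
      exact (hs W.2).2.1 q y hW
    · rw [iSup_sup]
      refine hF.iSup_mem E _ (fun a b ↦ ?_) fun W ↦ (hs W.2).2.2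
      obtain ⟨e, ha, hb⟩ := hd a b
      exact ⟨e, sup_le_sup_right ha _, sup_le_sup_right hb _⟩) ⊥ hbot
  have hmem (W' : ∀ q, Submodule R (E.X q)) (q : ι) (x : E.X q) :
      x ∈ (W' ⊔ I) q ↔ ∃ y, x - (i.f q).hom y ∈ W' q := by
    constructor
    · intro hx
      obtain ⟨a, ha, _, ⟨y, rfl⟩, rfl⟩ := Submodule.mem_sup.1 hx
      exact ⟨y, by simpa using ha⟩
    · rintro ⟨y, hy⟩
      exact Submodule.mem_sup.2 ⟨_, hy, _, ⟨y, rfl⟩, sub_add_cancel _ _⟩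
  obtain ⟨g, hg⟩ := exists_quo_desc hW (quoMk hV) fun q x hx ↦
    (quoMk_eq_zero hV).2 (Submodule.mem_sup_left hx)
  have hg' (q x) : (g.f q).hom (((quoMk hW).f q).hom x) = ((quoMk hV).f q).hom x :=
    congr((($hg).f q).hom x)
  obtain ⟨wg, hse⟩ := shortExact_quo hi hW hV hWi (hmem W) hg
  have htop (q : ι) (x : E.X q) : x ∈ (W ⊔ I) q := by
    obtain ⟨Z, hZ, hxZ, hsm, hsF, hZq, hqF⟩ := hF.exists_small _ hWF q (((quoMk hV).f q).hom x)
    obtain ⟨σ, hσ⟩ := (hY _ hsF hsm).exists_lift hse (subι hZ)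
    have hσ' (q s) : (g.f q).hom ((σ.f q).hom s) = ((subι hZ).f q).hom s :=
      congr((($hσ).f q).hom s)
    let W' (q : ι) : Submodule R (E.X q) :=
      (LinearMap.range (σ.f q).hom).comap ((quoMk hW).f q).hom
    have hW' : Stable E W' := fun i j x ↦ by
      rintro ⟨s, hs⟩
      exact ⟨del _ i j s, by rw [f_del, hs, f_del]⟩
    have hWW' : W ≤ W' := fun q x hx ↦ ⟨0, by rw [map_zero, (quoMk_eq_zero hW).2 hx]⟩
    have hW'Z (q x) : x ∈ (W' ⊔ I) q ↔ ((quoMk hV).f q).hom x ∈ Z q := by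
      rw [hmem]
      constructor
      · rintro ⟨y, s, hs⟩
        rw [← exists_subι_eq hZ]
        refine ⟨s, ?_⟩
        rw [← hσ', hs, hg', map_sub, sub_eq_self, quoMk_eq_zero]
        exact Submodule.mem_sup_right ⟨y, rfl⟩
      · intro hx
        obtain ⟨s, hs⟩ := (exists_subι_eq hZ).2 hx
        obtain ⟨x', hx'⟩ := quoMk_surjective hW q ((σ.f q).hom s)
        have : x - x' ∈ (W ⊔ I) q := by
          rw [← quoMk_eq_zero hV, map_sub, ← hg' q x', hx', hσ', hs, sub_self]
        obtain ⟨y, hy⟩ := (hmem W q _).1 this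
        refine ⟨y, ?_⟩
        have := add_mem (hWW' q hy) (show x' ∈ W' q from ⟨s, hx'.symm⟩)
        convert this using 1
        abel
    have hW'𝒮 : W' ∈ 𝒮 := by
      refine ⟨hW', fun q y ⟨s, hs⟩ ↦ hWi q y ?_, ?_⟩
      · have h₀ : ((subι hZ).f q).hom s = 0 := by
          rw [← hσ', hs, hg', quoMk_eq_zero]
          exact Submodule.mem_sup_right ⟨y, rfl⟩
        rw [← quoMk_eq_zero hW, ← hs, (injective_iff_map_eq_zero _).1 (subι_injective hZ q) s h₀,
          map_zero]
      · obtain ⟨e⟩ := nonempty_quo_iso (hW'.sup (stable_range i)) (quoMk hV ≫ quoMk hZq)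
          (fun q ↦ (quoMk_surjective hZq q).comp (quoMk_surjective hV q))
          fun q x ↦ (quoMk_eq_zero hZq).trans (hW'Z q x).symm
        exact ⟨_, hF.of_iso e hqF⟩
    exact sup_le_sup_right (hmax hW'𝒮 hWW') I q ((hW'Z q x).2 hxZ)
  apply ShortExact.exists_section hE
  have := mono_of_injective (i ≫ quoMk hW) fun q ↦ by
    rw [injective_iff_map_eq_zero]
    intro y hy
    exact (injective_iff_map_eq_zero _).1 (hi q) _ (hWi q y ((quoMk_eq_zero hW).1 hy))
  have := epi_of_surjective (i ≫ quoMk hW) fun q z ↦ by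
    obtain ⟨x, rfl⟩ := quoMk_surjective hW q z
    obtain ⟨y, hy⟩ := (hmem W q x).1 (htop q x)
    refine ⟨y, ?_⟩
    rw [← quoMk_eq_zero hW, map_sub, sub_eq_zero] at hy
    exact hy.symm
  have := isIso_of_mono_of_epi (i ≫ quoMk hW)
  exact ⟨quoMk hW ≫ inv (i ≫ quoMk hW), by rw [← Category.assoc, IsIso.hom_inv_id]⟩

end Deconstruction

section SmallSubcomplexes

variable {R : Type u} [Ring R] {ι : Type} {c : ComplexShape ι}

variable (R) in
/-- Formal expressions, graded by degree, in a variable of degree `q₀`, which are built from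
the operations of a complex of modules together with formal solutions of the linear systems
`∑ j, A i j • x j = z i + d (y i)`. -/
inductive Term (q₀ : ι) : ι → Type u
  | var : Term q₀ q₀
  | zero (q : ι) : Term q₀ q
  | add (q : ι) : Term q₀ q → Term q₀ q → Term q₀ q
  | smul (q : ι) : R → Term q₀ q → Term q₀ q
  | del (p q : ι) : Term q₀ p → Term q₀ q
  | solFst (p q : ι) (n m : ℕ) (A : Fin n → Fin m → R) (z : Fin n → Term q₀ q) (j : Fin m) :
    Term q₀ q
  | solSnd (p q : ι) (n m : ℕ) (A : Fin n → Fin m → R) (z : Fin n → Term q₀ q) (i : Fin n) :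
    Term q₀ p

/-- A solution of the linear system `∑ j, A i j • x j = z i + d (y i)`, if there is one. -/
noncomputable def systemSol (X : HomologicalComplex (ModuleCat.{u} R) c) (p q : ι) (n m : ℕ)
    (A : Fin n → Fin m → R) (z : Fin n → X.X q) : (Fin m → X.X q) × (Fin n → X.X p) :=
  Classical.epsilon fun s ↦ ∀ i, ∑ j, A i j • s.1 j = z i + del X p q (s.2 i)

lemma systemSol_spec {X : HomologicalComplex (ModuleCat.{u} R) c} {p q : ι} {n m : ℕ}
    {A : Fin n → Fin m → R} {z : Fin n → X.X q} {x : Fin m → X.X q} {y : Fin n → X.X p}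
    (h : ∀ i, ∑ j, A i j • x j = z i + del X p q (y i)) (i : Fin n) :
    ∑ j, A i j • (systemSol X p q n m A z).1 j =
      z i + del X p q ((systemSol X p q n m A z).2 i) :=
  Classical.epsilon_spec (p := fun s : (Fin m → X.X q) × (Fin n → X.X p) ↦
    ∀ i, ∑ j, A i j • s.1 j = z i + del X p q (s.2 i)) ⟨(x, y), h⟩ i

/-- The value of a formal expression. -/
noncomputable def Term.eval (X : HomologicalComplex (ModuleCat.{u} R) c) {q₀ : ι} (x : X.X q₀) :
    ∀ {q : ι}, Term R q₀ q → X.X q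
  | _, var => x
  | _, zero q => 0
  | _, add q s t => s.eval X x + t.eval X x
  | _, smul q r t => r • t.eval X x
  | _, del p q t => PeriodicCotorsion.del X p q (t.eval X x)
  | _, solFst p q n m A z j => (systemSol X p q n m A fun i ↦ (z i).eval X x).1 j
  | _, solSnd p q n m A z i => (systemSol X p q n m A fun i ↦ (z i).eval X x).2 i

/-- A graded submodule such that any linear system modulo boundaries with right hand sides in
the submodule that is solvable is already solvable in the submodule. -/
def SolvesSystems (X : HomologicalComplex (ModuleCat.{u} R) c) (Z : ∀ q, Submodule R (X.X q)) :
    Prop :=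
  ∀ (p q : ι) (n m : ℕ) (A : Fin n → Fin m → R) (z : Fin n → X.X q) (x : Fin m → X.X q)
    (y : Fin n → X.X p), (∀ i, z i ∈ Z q) → (∀ i, ∑ j, A i j • x j = z i + del X p q (y i)) →
    ∃ (x' : Fin m → X.X q) (y' : Fin n → X.X p), (∀ j, x' j ∈ Z q) ∧ (∀ i, y' i ∈ Z p) ∧
      ∀ i, ∑ j, A i j • x' j = z i + del X p q (y' i)

lemma exists_solvesSystems (X : HomologicalComplex (ModuleCat.{u} R) c) (q₀ : ι) (x : X.X q₀) :
    ∃ (Z : ∀ q, Submodule R (X.X q)) (hZ : Stable X Z), x ∈ Z q₀ ∧ IsSmall (Term R) (sub X Z hZ) ∧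
      SolvesSystems X Z := by
  let Z (q : ι) : Submodule R (X.X q) :=
    { carrier := Set.range (Term.eval X x (q := q))
      zero_mem' := ⟨.zero q, by simp only [Term.eval]⟩
      add_mem' := by
        rintro _ _ ⟨s, rfl⟩ ⟨t, rfl⟩
        exact ⟨.add q s t, by simp only [Term.eval]⟩
      smul_mem' := by
        rintro r _ ⟨t, rfl⟩
        exact ⟨.smul q r t, by simp only [Term.eval]⟩ }
  refine ⟨Z, ?_, ⟨.var, by simp only [Term.eval]⟩,
    ⟨q₀, fun q ↦ ⟨fun t ↦ (⟨t.eval X x, t, rfl⟩ : Z q), ?_⟩⟩, ?_⟩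
  · rintro p q _ ⟨t, rfl⟩
    exact ⟨.del p q t, by simp only [Term.eval]⟩
  · rintro ⟨_, t, rfl⟩
    exact ⟨t, rfl⟩
  · intro p q n m A z x' y' hz h
    choose t ht using hz
    obtain rfl : (fun i ↦ (t i).eval X x) = z := funext ht
    exact ⟨_, _, fun j ↦ ⟨.solFst p q n m A t j, by simp only [Term.eval]⟩,
      fun i ↦ ⟨.solSnd p q n m A t i, by simp only [Term.eval]⟩, systemSol_spec h⟩

lemma SolvesSystems.exists_del {X : HomologicalComplex (ModuleCat.{u} R) c}
    {Z : ∀ q, Submodule R (X.X q)} (hZ : SolvesSystems X Z) {p q : ι} (y : X.X p)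
    (hy : del X p q y ∈ Z q) : ∃ y' ∈ Z p, del X p q y' = del X p q y := by
  obtain ⟨_, y', _, hy', h⟩ := hZ p q 1 0 0 (fun _ ↦ - del X p q y) Fin.elim0 (fun _ ↦ y)
    (fun _ ↦ neg_mem hy) (by simp)
  exact ⟨y' 0, hy' 0, (neg_add_eq_zero.1 (by simpa using (h 0).symm)).symm⟩

end SmallSubcomplexes

section Classes

variable {R : Type u} [Ring R] {ι : Type} (c : ComplexShape ι) (𝓐 𝓑 : Set (ModuleCat.{u} R))

/-- The complexes whose differentials have cokernels in `𝓐`. -/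
def cokerClass : Set (HomologicalComplex (ModuleCat.{u} R) c) :=
  {X | ∀ p q, c.Rel p q → ModuleCat.of R (X.X q ⧸ LinearMap.range (del X p q)) ∈ 𝓐}

variable (R) in
/-- The exact complexes. -/
def exactClass : Set (HomologicalComplex (ModuleCat.{u} R) c) :=
  {X | ∀ i j k, c.Rel i j → c.Rel j k → ∀ x, del X j k x = 0 → ∃ y, del X i j y = x}

variable (R) in
/-- The complexes with zero differentials. -/
def zeroClass : Set (HomologicalComplex (ModuleCat.{u} R) c) :=
  {X | ∀ i j x, del X i j x = 0}

variable {c 𝓐 𝓑} (h𝓐 : IsPureCotorsionPair 𝓐 𝓑)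

include h𝓐

lemma IsPureCotorsionPair.quotient_mem {M N : Type u} [AddCommGroup M] [Module R M]
    [AddCommGroup N] [Module R N] (g : M →ₗ[R] N) (hg : Function.Surjective g)
    (hN : ModuleCat.of R N ∈ 𝓐) {U : Submodule R M} (hU : ∀ x, x ∈ U ↔ g x = 0) :
    ModuleCat.of R (M ⧸ U) ∈ 𝓐 := by
  obtain rfl : U = LinearMap.ker g := by
    ext x
    exact hU x
  exact h𝓐.left_of_equiv (g.quotKerEquivOfSurjective hg).symm hN

lemma cokerClass_of_iso {X Y : HomologicalComplex (ModuleCat.{u} R) c} (e : X ≅ Y)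
    (hX : X ∈ cokerClass c 𝓐) : Y ∈ cokerClass c 𝓐 := fun p q h ↦ by
  have he (q) (y : Y.X q) : (e.hom.f q).hom ((e.inv.f q).hom y) = y :=
    comp_apply_eq_self e.inv_hom_id q y
  have he' (q) (x : X.X q) : (e.inv.f q).hom ((e.hom.f q).hom x) = x :=
    comp_apply_eq_self e.hom_inv_id q x
  refine h𝓐.quotient_mem ((LinearMap.range (del X p q)).mkQ ∘ₗ (e.inv.f q).hom)
    ((Submodule.mkQ_surjective _).comp fun x ↦ ⟨_, he' q x⟩) (hX p q h) fun y ↦ ?_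
  rw [LinearMap.comp_apply, Submodule.mkQ_apply, Submodule.Quotient.mk_eq_zero]
  constructor
  · rintro ⟨y, rfl⟩
    exact ⟨(e.inv.f p).hom y, by rw [f_del]⟩
  · rintro ⟨x, hx⟩
    exact ⟨(e.hom.f p).hom x, by rw [← f_del, hx, he]⟩

lemma quo_mem_cokerClass_iff {X : HomologicalComplex (ModuleCat.{u} R) c}
    {U : ∀ q, Submodule R (X.X q)} (hU : Stable X U) :
    quo X U hU ∈ cokerClass c 𝓐 ↔ ∀ p q, c.Rel p q →
      ModuleCat.of R (X.X q ⧸ (LinearMap.range (del X p q) ⊔ U q)) ∈ 𝓐 := by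
  have key (p q : ι) (x : X.X q) : (U q).mkQ x ∈ LinearMap.range (del (quo X U hU) p q) ↔
      x ∈ LinearMap.range (del X p q) ⊔ U q := by
    constructor
    · rintro ⟨y, hy⟩
      obtain ⟨y, rfl⟩ := quoMk_surjective hU p y
      have : x - del X p q y ∈ U q := by
        rw [← f_del] at hy
        exact (Submodule.Quotient.eq _).1 hy.symm
      rw [← add_sub_cancel (del X p q y) x]
      exact Submodule.add_mem_sup ⟨y, rfl⟩ this
    · intro hx
      obtain ⟨_, ⟨y, rfl⟩, z, hz, rfl⟩ := Submodule.mem_sup.1 hx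
      refine ⟨((quoMk hU).f p).hom y, (f_del (quoMk hU) p q y).symm.trans ?_⟩
      refine (Submodule.Quotient.eq _).2 ?_
      rw [sub_add_cancel_left]
      exact neg_mem hz
  refine forall_congr' fun p ↦ forall_congr' fun q ↦ imp_congr Iff.rfl ?_
  constructor
  · intro h
    refine h𝓐.quotient_mem ((LinearMap.range (del (quo X U hU) p q)).mkQ ∘ₗ (U q).mkQ)
      ((Submodule.mkQ_surjective _).comp (Submodule.mkQ_surjective _)) h fun x ↦ ?_
    rw [← key]
    exact (Submodule.Quotient.mk_eq_zero _).symm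
  · intro h
    refine h𝓐.quotient_mem (M := X.X q ⧸ U q)
      (Submodule.factor (le_sup_right : U q ≤ LinearMap.range (del X p q) ⊔ U q))
      (Submodule.factor_surjective le_sup_right) h fun x ↦ ?_
    obtain ⟨x, rfl⟩ := (U q).mkQ_surjective x
    refine (key p q x).trans ?_
    exact (Submodule.Quotient.mk_eq_zero _).symm

lemma iSup_mem_cokerClass {X : HomologicalComplex (ModuleCat.{u} R) c} {I : Type u} [Nonempty I]
    (U : I → ∀ q, Submodule R (X.X q)) (hd : Directed (· ≤ ·) U)
    (hU : ∀ i, QuoMem (cokerClass c 𝓐) X (U i)) : QuoMem (cokerClass c 𝓐) X (⨆ i, U i) := by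
  choose hst hmem using hU
  refine ⟨.iSup hd hst, (quo_mem_cokerClass_iff h𝓐 _).2 fun p q h ↦ ?_⟩
  rw [iSup_apply, sup_iSup]
  refine h𝓐.quotient_iSup_mem _ (fun a b ↦ ?_) fun i ↦
    (quo_mem_cokerClass_iff h𝓐 _).1 (hmem i) p q h
  obtain ⟨e, ha, hb⟩ := hd a b
  exact ⟨e, sup_le_sup_left (ha q) _, sup_le_sup_left (hb q) _⟩

lemma SolvesSystems.quo_mem_cokerClass {X : HomologicalComplex (ModuleCat.{u} R) c}
    (hX : X ∈ cokerClass c 𝓐) {Z : ∀ q, Submodule R (X.X q)} (hZ : Stable X Z)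
    (hs : SolvesSystems X Z) : quo X Z hZ ∈ cokerClass c 𝓐 := by
  refine (quo_mem_cokerClass_iff h𝓐 _).2 fun p q h ↦
    h𝓐.pure_quotient_mem le_sup_left (hX p q h) fun n m A x hx ↦ ?_
  have (i : Fin n) : ∃ (z : X.X q) (y : X.X p), z ∈ Z q ∧
      ∑ j, A i j • x j = z + del X p q y := by
    obtain ⟨_, ⟨y, rfl⟩, z, hz, h⟩ := Submodule.mem_sup.1 (hx i)
    exact ⟨z, y, hz, by rw [← h, add_comm]⟩
  choose z y hz hzy using this
  obtain ⟨x', y', hx', hy', h'⟩ := hs p q n m A z x y hz hzy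
  refine ⟨fun j ↦ x j - x' j, fun j ↦ ?_, fun i ↦ ⟨y i - y' i, ?_⟩⟩
  · rw [sub_sub_cancel_left]
    exact Submodule.mem_sup_right (neg_mem (hx' j))
  · simp only [smul_sub, Finset.sum_sub_distrib, hzy, h', map_sub]
    abel

lemma SolvesSystems.sub_mem_cokerClass {X : HomologicalComplex (ModuleCat.{u} R) c}
    (hX : X ∈ cokerClass c 𝓐) {Z : ∀ q, Submodule R (X.X q)} (hZ : Stable X Z)
    (hs : SolvesSystems X Z) : sub X Z hZ ∈ cokerClass c 𝓐 := fun p q h ↦ by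
  have hle : LinearMap.range (del X p q) ≤ LinearMap.range (del X p q) ⊔ Z q := le_sup_left
  have hker := h𝓐.ker_mem (Submodule.factor hle) (Submodule.factor_surjective hle) (hX p q h)
    ((quo_mem_cokerClass_iff h𝓐 _).1 (hs.quo_mem_cokerClass h𝓐 hX hZ) p q h)
  refine h𝓐.quotient_mem (M := Z q) (((LinearMap.range (del X p q)).mkQ ∘ₗ (Z q).subtype).codRestrict
    (LinearMap.ker (Submodule.factor hle)) fun z ↦ ?_) ?_ hker fun z ↦ ?_
  · exact (Submodule.Quotient.mk_eq_zero _).2 (Submodule.mem_sup_right z.2)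
  · rintro ⟨x, hx⟩
    obtain ⟨x, rfl⟩ := Submodule.mkQ_surjective _ x
    obtain ⟨_, ⟨y, rfl⟩, z, hz, h⟩ := Submodule.mem_sup.1 ((Submodule.Quotient.mk_eq_zero _).1 hx)
    refine ⟨⟨z, hz⟩, Subtype.ext ((Submodule.Quotient.eq _).2 ⟨- y, ?_⟩)⟩
    have h' : del X p q y + z = x := h
    rw [← h', map_neg]
    simp
  · rw [← Submodule.coe_eq_zero]
    refine Iff.trans ?_ (Submodule.Quotient.mk_eq_zero (LinearMap.range (del X p q))).symm
    constructor
    · rintro ⟨y, rfl⟩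
      exact ⟨y.1, rfl⟩
    · rintro ⟨y, hy⟩
      obtain ⟨y', hy', h⟩ := hs.exists_del y (Set.mem_of_eq_of_mem hy z.2)
      exact ⟨⟨y', hy'⟩, Subtype.ext (h.trans hy)⟩

omit h𝓐

lemma quo_mem_exactClass_iff {X : HomologicalComplex (ModuleCat.{u} R) c}
    {U : ∀ q, Submodule R (X.X q)} (hU : Stable X U) :
    quo X U hU ∈ exactClass R c ↔ ∀ i j k, c.Rel i j → c.Rel j k → ∀ x, del X j k x ∈ U k →
      ∃ y, x - del X i j y ∈ U j := by
  refine forall_congr' fun i ↦ forall_congr' fun j ↦ forall_congr' fun k ↦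
    imp_congr Iff.rfl (imp_congr Iff.rfl ?_)
  rw [(quoMk_surjective hU j).forall]
  refine forall_congr' fun x ↦ imp_congr ?_ ?_
  · rw [← f_del, quoMk_eq_zero]
  · rw [(quoMk_surjective hU i).exists]
    refine exists_congr fun y ↦ ?_
    rw [← f_del, eq_comm, ← sub_eq_zero, ← map_sub, quoMk_eq_zero]

lemma quo_mem_zeroClass_iff {X : HomologicalComplex (ModuleCat.{u} R) c}
    {U : ∀ q, Submodule R (X.X q)} (hU : Stable X U) :
    quo X U hU ∈ zeroClass R c ↔ ∀ i j x, del X i j x ∈ U j := by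
  refine forall_congr' fun i ↦ forall_congr' fun j ↦ ?_
  rw [(quoMk_surjective hU i).forall]
  refine forall_congr' fun x ↦ ?_
  rw [← f_del, quoMk_eq_zero]

lemma exactClass_of_iso {X Y : HomologicalComplex (ModuleCat.{u} R) c} (e : X ≅ Y)
    (hX : X ∈ exactClass R c) : Y ∈ exactClass R c := fun i j k hij hjk y hy ↦ by
  obtain ⟨x, hx⟩ := hX i j k hij hjk ((e.inv.f j).hom y) (by rw [← f_del, hy, map_zero])
  exact ⟨(e.hom.f i).hom x, by rw [← f_del, hx, comp_apply_eq_self e.inv_hom_id]⟩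

lemma zeroClass_of_iso {X Y : HomologicalComplex (ModuleCat.{u} R) c} (e : X ≅ Y)
    (hX : X ∈ zeroClass R c) : Y ∈ zeroClass R c := fun i j y ↦ by
  rw [← comp_apply_eq_self e.inv_hom_id i y, ← f_del, hX, map_zero]

lemma directed_apply {X : HomologicalComplex (ModuleCat.{u} R) c} {I : Type u}
    {U : I → ∀ q, Submodule R (X.X q)} (hd : Directed (· ≤ ·) U) (q : ι) :
    Directed (· ≤ ·) fun i ↦ U i q := fun a b ↦ by
  obtain ⟨e, ha, hb⟩ := hd a b
  exact ⟨e, ha q, hb q⟩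

lemma iSup_mem_exactClass {X : HomologicalComplex (ModuleCat.{u} R) c} {I : Type u} [Nonempty I]
    (U : I → ∀ q, Submodule R (X.X q)) (hd : Directed (· ≤ ·) U)
    (hU : ∀ i, QuoMem (exactClass R c) X (U i)) : QuoMem (exactClass R c) X (⨆ i, U i) := by
  choose hst hmem using hU
  refine ⟨.iSup hd hst, (quo_mem_exactClass_iff _).2 fun i j k hij hjk x hx ↦ ?_⟩
  rw [iSup_apply, Submodule.mem_iSup_of_directed _ (directed_apply hd k)] at hx
  obtain ⟨a, ha⟩ := hx
  obtain ⟨y, hy⟩ := (quo_mem_exactClass_iff _).1 (hmem a) i j k hij hjk x ha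
  exact ⟨y, le_iSup U a j hy⟩

lemma iSup_mem_zeroClass {X : HomologicalComplex (ModuleCat.{u} R) c} {I : Type u} [Nonempty I]
    (U : I → ∀ q, Submodule R (X.X q)) (hd : Directed (· ≤ ·) U)
    (hU : ∀ i, QuoMem (zeroClass R c) X (U i)) : QuoMem (zeroClass R c) X (⨆ i, U i) := by
  choose hst hmem using hU
  exact ⟨.iSup hd hst, (quo_mem_zeroClass_iff _).2 fun i j x ↦
    le_iSup U (Classical.arbitrary I) j ((quo_mem_zeroClass_iff _).1 (hmem _) i j x)⟩

lemma SolvesSystems.quo_mem_exactClass {X : HomologicalComplex (ModuleCat.{u} R) c}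
    (hX : X ∈ exactClass R c) {Z : ∀ q, Submodule R (X.X q)} (hZ : Stable X Z)
    (hs : SolvesSystems X Z) : quo X Z hZ ∈ exactClass R c :=
  (quo_mem_exactClass_iff _).2 fun i j k hij hjk x hx ↦ by
    obtain ⟨x', hx', h⟩ := hs.exists_del x hx
    obtain ⟨y, hy⟩ := hX i j k hij hjk (x - x') (by rw [map_sub, h, sub_self])
    exact ⟨y, by rwa [hy, sub_sub_cancel]⟩

lemma SolvesSystems.sub_mem_exactClass {X : HomologicalComplex (ModuleCat.{u} R) c}
    (hX : X ∈ exactClass R c) {Z : ∀ q, Submodule R (X.X q)} (hZ : Stable X Z)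
    (hs : SolvesSystems X Z) : sub X Z hZ ∈ exactClass R c := fun i j k hij hjk x hx ↦ by
  obtain ⟨y, hy⟩ := hX i j k hij hjk ((subι hZ).f j |>.hom x) (by rw [← f_del, hx, map_zero])
  obtain ⟨y', hy', h⟩ := hs.exists_del y ((exists_subι_eq hZ).1 ⟨x, hy.symm⟩)
  exact ⟨(⟨y', hy'⟩ : Z i), Subtype.ext (h.trans hy)⟩

include h𝓐

lemma isDeconstructible_exact :
    IsDeconstructible (Term R) (cokerClass c 𝓐 ∩ exactClass R c) where
  of_iso e h := ⟨cokerClass_of_iso h𝓐 e h.1, exactClass_of_iso e h.2⟩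
  exists_small X hX q₀ x := by
    obtain ⟨Z, hZ, hx, hsm, hs⟩ := exists_solvesSystems X q₀ x
    exact ⟨Z, hZ, hx, hsm, ⟨hs.sub_mem_cokerClass h𝓐 hX.1 hZ, hs.sub_mem_exactClass hX.2 hZ⟩,
      hZ, hs.quo_mem_cokerClass h𝓐 hX.1 hZ, hs.quo_mem_exactClass hX.2 hZ⟩
  iSup_mem X I _ U hd hU := by
    obtain ⟨_, h₁⟩ := iSup_mem_cokerClass h𝓐 U hd fun i ↦ (hU i).imp fun _ h ↦ h.1
    obtain ⟨_, h₂⟩ := iSup_mem_exactClass U hd fun i ↦ (hU i).imp fun _ h ↦ h.2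
    exact ⟨_, h₁, h₂⟩

lemma isDeconstructible_zero :
    IsDeconstructible (Term R) (cokerClass c 𝓐 ∩ zeroClass R c) where
  of_iso e h := ⟨cokerClass_of_iso h𝓐 e h.1, zeroClass_of_iso e h.2⟩
  exists_small X hX q₀ x := by
    obtain ⟨Z, hZ, hx, hsm, hs⟩ := exists_solvesSystems X q₀ x
    exact ⟨Z, hZ, hx, hsm, ⟨hs.sub_mem_cokerClass h𝓐 hX.1 hZ,
        fun i j x ↦ Subtype.ext (hX.2 i j x.1)⟩,
      hZ, hs.quo_mem_cokerClass h𝓐 hX.1 hZ, (quo_mem_zeroClass_iff hZ).2 fun i j x ↦ by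
        rw [hX.2]
        exact zero_mem _⟩
  iSup_mem X I _ U hd hU := by
    obtain ⟨_, h₁⟩ := iSup_mem_cokerClass h𝓐 U hd fun i ↦ (hU i).imp fun _ h ↦ h.1
    obtain ⟨_, h₂⟩ := iSup_mem_zeroClass U hd fun i ↦ (hU i).imp fun _ h ↦ h.2
    exact ⟨_, h₁, h₂⟩

end Classes

section Constant

variable {R : Type u} [Ring R] {ι : Type} {c : ComplexShape ι}

variable (c) in
/-- The complex with all components equal to `B` and zero differentials. -/
def constComplex (B : ModuleCat.{u} R) : HomologicalComplex (ModuleCat.{u} R) c :=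
  mkComplex c (fun _ ↦ B) (fun _ _ ↦ 0) (fun _ _ _ ↦ rfl) (fun _ _ _ _ _ ↦ rfl)

/-- The morphism of constant complexes induced by a morphism of modules. -/
def constMap {B B' : ModuleCat.{u} R} (f : B ⟶ B') : constComplex c B ⟶ constComplex c B' :=
  mkHom (fun _ ↦ f.hom) fun _ _ _ _ ↦ f.hom.map_zero

lemma shortExact_constMap {X₁ X₂ X₃ : ModuleCat.{u} R} {i : X₁ ⟶ X₂} {p : X₂ ⟶ X₃} {w : i ≫ p = 0}
    (h : (ShortComplex.mk i p w).ShortExact) :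
    ∃ w' : constMap (c := c) i ≫ constMap p = 0,
      (ShortComplex.mk (constMap i) (constMap p) w').ShortExact := by
  refine ⟨?_, shortExact_of_degreewise _ _ _ (fun _ ↦ ?_) (fun _ ↦ ?_) fun _ ↦ ?_⟩
  · ext q x
    exact congr($w x)
  · exact (ModuleCat.mono_iff_injective _).1 h.mono_f
  · exact (ModuleCat.epi_iff_surjective _).1 h.epi_g
  · exact (ShortComplex.moduleCat_exact_iff _).1 h.exact

open Classical in
lemma exists_hom_const (X : HomologicalComplex (ModuleCat.{u} R) c) {i j : ι} (hij : c.Rel i j)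
    {B : ModuleCat.{u} R} (f : X.X j →ₗ[R] B) (hf : ∀ x, f (del X i j x) = 0) :
    ∃ g : X ⟶ constComplex c B, (g.f j).hom = f := by
  let φ : ∀ q, X.X q →ₗ[R] B := Function.update (fun _ ↦ 0) j f
  have hφ : φ j = f := Function.update_self ..
  have h (k l) (hkl : c.Rel k l) (x : X.X k) : φ l (del X k l x) = 0 := by
    by_cases hl : l = j
    · subst hl
      obtain rfl := c.prev_eq hij hkl
      rw [hφ, hf]
    · rw [show φ l = 0 from Function.update_of_ne hl ..]
      rfl
  exact ⟨mkHom (Y := constComplex c B) φ h, hφ⟩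

open Classical in
lemma exists_const_hom (X : HomologicalComplex (ModuleCat.{u} R) c) {j k : ι} (hjk : c.Rel j k)
    {B : ModuleCat.{u} R} (f : B →ₗ[R] X.X j) (hf : ∀ b, del X j k (f b) = 0) :
    ∃ g : constComplex c B ⟶ X, (g.f j).hom = f := by
  let φ : ∀ q, B →ₗ[R] X.X q := Function.update (fun _ ↦ 0) j f
  have hφ : φ j = f := Function.update_self ..
  have h (l m) (hlm : c.Rel l m) (b : B) : del X l m (φ l b) = 0 := by
    by_cases hl : l = j
    · subst hl
      obtain rfl := c.next_eq hjk hlm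
      rw [hφ, hf]
    · rw [show φ l = 0 from Function.update_of_ne hl ..]
      exact map_zero _
  exact ⟨mkHom (X := constComplex c B) φ fun l m hlm b ↦ (map_zero (φ m)).trans (h l m hlm b).symm,
    hφ⟩

variable (c) in
open Classical in
/-- The differentials `(a, b) ↦ (b, 0)`. -/
noncomputable def doubleDel (J : ModuleCat.{u} R) (i j : ι) : J × J →ₗ[R] J × J :=
  if c.Rel i j then LinearMap.inl R J J ∘ₗ LinearMap.snd R J J else 0

lemma doubleDel_apply (J : ModuleCat.{u} R) {i j : ι} (h : c.Rel i j) (x : J × J) :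
    doubleDel c J i j x = (x.2, 0) := by
  simp [doubleDel, h]

variable (c) in
/-- The complex with all components equal to `J × J` and differentials `(a, b) ↦ (b, 0)`. -/
noncomputable def doubleComplex (J : ModuleCat.{u} R) : HomologicalComplex (ModuleCat.{u} R) c :=
  mkComplex c (fun _ ↦ J × J) (doubleDel c J) (fun i j h ↦ if_neg h) fun i j k h h' ↦ by
    refine LinearMap.ext fun x ↦ ?_
    rw [LinearMap.comp_apply, doubleDel_apply J h, doubleDel_apply J h']
    rfl

lemma del_doubleComplex {J : ModuleCat.{u} R} {i j : ι} (h : c.Rel i j) (x : J × J) :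
    del (doubleComplex c J) i j x = ((x.2, 0) : J × J) :=
  doubleDel_apply J h x

variable (c) in
/-- The inclusion `a ↦ (a, 0)`. -/
noncomputable def doubleInl (J : ModuleCat.{u} R) : constComplex c J ⟶ doubleComplex c J :=
  mkHom (X := constComplex c J) (Y := doubleComplex c J) (fun _ ↦ LinearMap.inl R J J)
    fun _ _ h x ↦ (map_zero (LinearMap.inl R J J)).trans
      (del_doubleComplex h (LinearMap.inl R J J x)).symm

variable (c) in
/-- The projection `(a, b) ↦ b`. -/
noncomputable def doubleSnd (J : ModuleCat.{u} R) : doubleComplex c J ⟶ constComplex c J :=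
  mkHom (X := doubleComplex c J) (Y := constComplex c J) (fun _ ↦ LinearMap.snd R J J)
    fun _ _ h x ↦ congr(LinearMap.snd R J J $(del_doubleComplex h x))

lemma shortExact_double (J : ModuleCat.{u} R) :
    ∃ w : doubleInl c J ≫ doubleSnd c J = 0,
      (ShortComplex.mk (doubleInl c J) (doubleSnd c J) w).ShortExact := by
  refine ⟨rfl, shortExact_of_degreewise _ _ _ (fun _ ↦ ?_) (fun _ ↦ ?_) fun _ x hx ↦ ?_⟩
  · exact LinearMap.inl_injective (R := R) (M := J) (M₂ := J)
  · exact LinearMap.snd_surjective (R := R) (M := J) (M₂ := J)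
  · exact ⟨(show J × J from x).1, Prod.ext rfl (Eq.symm hx)⟩

end Constant

section Orthogonality

variable {R : Type u} [Ring R] {ι : Type} {c : ComplexShape ι} {𝓐 𝓑 : Set (ModuleCat.{u} R)}

variable (c 𝓑) in
/-- The complexes whose differentials have kernels in `𝓑`. -/
def kerClass : Set (HomologicalComplex (ModuleCat.{u} R) c) :=
  {X | ∀ q r, c.Rel q r → ModuleCat.of R (LinearMap.ker (del X q r)) ∈ 𝓑}

lemma shortExact_of_linearMap {A B C : Type u} [AddCommGroup A] [Module R A] [AddCommGroup B]
    [Module R B] [AddCommGroup C] [Module R C] {i : A →ₗ[R] B} {p : B →ₗ[R] C}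
    (hi : Function.Injective i) (hp : Function.Surjective p) (hip : ∀ x, p (i x) = 0)
    (h : ∀ y, p y = 0 → ∃ x, i x = y) :
    ∃ w : ModuleCat.ofHom i ≫ ModuleCat.ofHom p = 0,
      (ShortComplex.mk (ModuleCat.ofHom i) (ModuleCat.ofHom p) w).ShortExact := by
  refine ⟨by ext x; exact hip x, ?_⟩
  have : Mono (ModuleCat.ofHom i) := (ModuleCat.mono_iff_injective _).2 hi
  have : Epi (ModuleCat.ofHom p) := (ModuleCat.epi_iff_surjective _).2 hp
  exact { exact := (ShortComplex.moduleCat_exact_iff _).2 h }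

variable (h𝓐 : IsPureCotorsionPair 𝓐 𝓑)

include h𝓐

lemma extSplits_const (hc : ∀ q, ∃ p, c.Rel p q) {X : HomologicalComplex (ModuleCat.{u} R) c}
    (hX : X ∈ cokerClass c 𝓐 ∩ exactClass R c) {B : ModuleCat.{u} R} (hB : B ∈ 𝓑) :
    ExtSplits X (constComplex c B) := by
  intro E i p w hE
  have : Mono i := hE.mono_f
  have : Epi p := hE.epi_g
  let iq (q : ι) : B →ₗ[R] E.X q := (i.f q).hom
  have hi (q : ι) : Function.Injective (iq q) := injective_of_mono i q
  have hp := surjective_of_epi p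
  have hpi (q : ι) (b : B) : (p.f q).hom (iq q b) = 0 := comp_apply_eq_zero w q b
  have hex (q : ι) (e : E.X q) (he : (p.f q).hom e = 0) : ∃ b, iq q b = e :=
    exists_eq_of_shortExact hE q e he
  choose pr hpr using hc
  have hdel (o q : ι) (b : B) : del E o q (iq o b) = 0 :=
    (f_del i o q b).symm.trans (map_zero _)
  have key (q : ι) : ∃ r : E.X q →ₗ[R] B, (∀ b : B, r (iq q b) = b) ∧
      ∀ e, r (del E (pr q) q e) = 0 := by
    let D := LinearMap.range (del E (pr q) q)
    let D' := LinearMap.range (del X (pr q) q)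
    have hD : D ≤ D'.comap (p.f q).hom := by
      rintro _ ⟨e, rfl⟩
      exact ⟨_, (f_del p _ _ e).symm⟩
    obtain ⟨w', hse⟩ := shortExact_of_linearMap (A := B) (i := D.mkQ ∘ₗ iq q)
      (p := D.mapQ D' (p.f q).hom hD) (by
        rw [injective_iff_map_eq_zero]
        intro b hb
        obtain ⟨e, he⟩ := (Submodule.Quotient.mk_eq_zero D).1 hb
        obtain ⟨x, hx⟩ := hX.2 (pr (pr q)) (pr q) q (hpr _) (hpr _) ((p.f (pr q)).hom e) (by
          rw [← f_del, he, hpi])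
        obtain ⟨e', rfl⟩ := hp _ x
        obtain ⟨b', hb'⟩ := hex _ (e - del E _ _ e') (by
          rw [map_sub, f_del, hx, sub_self])
        have h₀ := hdel (pr q) q b'
        rw [hb', map_sub, del_del, sub_zero, he] at h₀
        exact (injective_iff_map_eq_zero _).1 (hi q) b h₀) (fun x ↦ by
        obtain ⟨x, rfl⟩ := D'.mkQ_surjective x
        obtain ⟨e, rfl⟩ := hp q x
        exact ⟨D.mkQ e, rfl⟩) (fun b ↦ by
        refine (Submodule.Quotient.mk_eq_zero D').2 ?_
        rw [hpi]
        exact zero_mem _) fun e he ↦ by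
        obtain ⟨e, rfl⟩ := D.mkQ_surjective e
        obtain ⟨x, hx⟩ := (Submodule.Quotient.mk_eq_zero D').1 he
        obtain ⟨e', rfl⟩ := hp _ x
        rw [← f_del] at hx
        obtain ⟨b, hb⟩ := hex q (e - del E _ _ e') (by
          rw [map_sub, hx, sub_self])
        exact ⟨b, (Submodule.Quotient.eq D).2 ⟨- e', by rw [hb, map_neg]; abel⟩⟩
    obtain ⟨r, hr⟩ := ShortExact.exists_retraction hse
      ((h𝓐.mem_left_iff _).1 (hX.1 (pr q) q (hpr q)) B hB _ _ w' hse)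
    refine ⟨r.hom ∘ₗ D.mkQ, fun b ↦ congr($hr b), fun e ↦ ?_⟩
    have : D.mkQ (del E (pr q) q e) = 0 := (Submodule.Quotient.mk_eq_zero D).2 ⟨e, rfl⟩
    exact (congrArg r.hom this).trans (map_zero _)
  choose r hr hrd using key
  apply ShortExact.exists_section hE
  refine ⟨mkHom (Y := constComplex c B) r fun k l hkl e ↦ ?_, ?_⟩
  · obtain rfl := c.prev_eq hkl (hpr l)
    exact hrd l e
  · ext q b
    exact hr q b

lemma mem_of_extSplits_const {X : HomologicalComplex (ModuleCat.{u} R) c}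
    (hX : ∀ B ∈ 𝓑, ExtSplits X (constComplex c B)) : X ∈ cokerClass c 𝓐 ∩ exactClass R c := by
  constructor
  · intro p q hpq
    refine (h𝓐.mem_left_iff _).2 fun B hB ↦
      .of_forall_lift (shortExact_mk_cokernel (Injective.ι B)) fun f ↦ ?_
    let D := LinearMap.range (del X p q)
    have hD (x) : D.mkQ (del X p q x) = 0 := (Submodule.Quotient.mk_eq_zero D).2 ⟨x, rfl⟩
    obtain ⟨F, hF⟩ := exists_hom_const X hpq (f.hom ∘ₗ D.mkQ) fun x ↦ by
      rw [LinearMap.comp_apply, hD]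
      exact map_zero _
    obtain ⟨w, hse⟩ := shortExact_constMap (c := c) (shortExact_mk_cokernel (Injective.ι B))
    obtain ⟨G, hG⟩ := (hX B hB).exists_lift hse F
    refine ⟨ModuleCat.ofHom (D.liftQ (G.f q).hom ?_), ?_⟩
    · rintro _ ⟨x, rfl⟩
      exact f_del G p q x
    · ext x
      refine Eq.trans ?_ congr($hF x)
      exact congr((($hG).f q).hom x)
  · intro i j k hij hjk x hx
    let D := LinearMap.range (del X i j)
    let J := Injective.under (ModuleCat.of R (X.X j ⧸ D))
    let ιJ : ModuleCat.of R (X.X j ⧸ D) ⟶ J := Injective.ι _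
    have hιJ : Function.Injective ιJ.hom := (ModuleCat.mono_iff_injective _).1 inferInstance
    have hD (x) : D.mkQ (del X i j x) = 0 := (Submodule.Quotient.mk_eq_zero D).2 ⟨x, rfl⟩
    obtain ⟨F, hF⟩ := exists_hom_const X hij (ιJ.hom ∘ₗ D.mkQ) fun x ↦ by
      rw [LinearMap.comp_apply, hD]
      exact map_zero _
    obtain ⟨w, hse⟩ := shortExact_double (c := c) J
    obtain ⟨G, hG⟩ := (hX J (h𝓐.right_of_injective J)).exists_lift hse F
    let y : J × J := (G.f j).hom x
    have h₁ : (y.2, 0) = (0 : J × J) :=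
      (del_doubleComplex hjk y).symm.trans
        ((f_del G j k x).symm.trans (by rw [hx]; exact map_zero _))
    have h₂ : y.2 = 0 := congr(($h₁).1)
    have h₃ : (F.f j).hom x = 0 := by
      rw [← hG]
      exact h₂
    rw [hF] at h₃
    exact (Submodule.Quotient.mk_eq_zero D).1 ((injective_iff_map_eq_zero _).1 hιJ _ h₃)

lemma extSplits_of_mem_zeroClass (hc : ∀ q, ∃ p, c.Rel p q) (hc' : ∀ q, ∃ r, c.Rel q r)
    {W X : HomologicalComplex (ModuleCat.{u} R) c} (hW : W ∈ cokerClass c 𝓐 ∩ zeroClass R c)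
    (hX : X ∈ kerClass c 𝓑 ∩ exactClass R c) : ExtSplits W X := by
  intro E i p w hE
  have : Mono i := hE.mono_f
  have : Epi p := hE.epi_g
  have hi := injective_of_mono i
  have hp := surjective_of_epi p
  choose nx hnx using hc'
  have key (q : ι) : ∃ s : W.X q →ₗ[R] E.X q, (∀ x, (p.f q).hom (s x) = x) ∧
      ∀ x, del E q (nx q) (s x) = 0 := by
    obtain ⟨o, ho⟩ := hc q
    have hWq : ModuleCat.of R (W.X q) ∈ 𝓐 := by
      refine h𝓐.left_of_equiv (Submodule.quotEquivOfEqBot _ ?_) (hW.1 o q ho)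
      rw [LinearMap.range_eq_bot]
      ext x
      exact hW.2 o q x
    obtain ⟨w', hse⟩ := shortExact_of_linearMap (A := LinearMap.ker (del X q (nx q)))
      (B := LinearMap.ker (del E q (nx q)))
      (i := (i.f q).hom.restrict fun x hx ↦ by
        rw [LinearMap.mem_ker] at hx ⊢
        rw [← f_del, hx, map_zero])
      (p := (p.f q).hom ∘ₗ Submodule.subtype _)
      (fun x y hxy ↦ Subtype.ext (hi q congr(($hxy).1))) (fun z ↦ by
        obtain ⟨e, rfl⟩ := hp q z
        obtain ⟨x, hx⟩ := exists_eq_of_shortExact hE (nx q) (del E q (nx q) e) (by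
          rw [f_del, hW.2])
        obtain ⟨x', rfl⟩ := hX.2 q (nx q) (nx (nx q)) (hnx _) (hnx _) x (by
          apply hi
          rw [f_del, hx, del_del, map_zero])
        refine ⟨⟨e - (i.f q).hom x', ?_⟩, ?_⟩
        · rw [LinearMap.mem_ker, map_sub, ← f_del, hx, sub_self]
        · simp only [LinearMap.comp_apply, Submodule.subtype_apply, map_sub,
            comp_apply_eq_zero w, sub_zero])
      (fun x ↦ comp_apply_eq_zero w q x.1) (fun e he ↦ by
        obtain ⟨x, hx⟩ := exists_eq_of_shortExact hE q e.1 he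
        refine ⟨⟨x, ?_⟩, Subtype.ext hx⟩
        rw [LinearMap.mem_ker]
        apply hi
        rw [f_del, hx, map_zero]
        exact e.2)
    obtain ⟨s, hs⟩ := (h𝓐.mem_left_iff _).1 hWq _ (hX.1 q (nx q) (hnx q)) _ _ w' hse
    exact ⟨Submodule.subtype _ ∘ₗ s.hom, fun x ↦ congr($hs x), fun x ↦ (s.hom x).2⟩
  choose s hs hsd using key
  refine ⟨mkHom s fun k l hkl x ↦ ?_, ?_⟩
  · obtain rfl := c.next_eq hkl (hnx k)
    rw [hW.2, map_zero, hsd]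
  · ext q x
    exact hs q x

lemma constComplex_mem {A : ModuleCat.{u} R} (hA : A ∈ 𝓐) :
    constComplex c A ∈ cokerClass c 𝓐 ∩ zeroClass R c := by
  refine ⟨fun p q _ ↦ ?_, fun _ _ _ ↦ rfl⟩
  exact h𝓐.left_of_equiv (Submodule.quotEquivOfEqBot _ (LinearMap.range_eq_bot.2 rfl)).symm hA

lemma mem_of_forall_zeroClass
    {X : HomologicalComplex (ModuleCat.{u} R) c}
    (hX : ∀ A ∈ 𝓐, ExtSplits (constComplex c A) X) : X ∈ kerClass c 𝓑 ∩ exactClass R c := by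
  constructor
  · intro q r hqr
    refine (h𝓐.mem_right_iff _).2 fun A hA ↦
      .of_forall_extension (shortExact_mk_kernel (Projective.π A)) fun f ↦ ?_
    obtain ⟨F, hF⟩ := exists_const_hom X hqr (Submodule.subtype _ ∘ₗ f.hom) fun x ↦ (f.hom x).2
    obtain ⟨w, hse⟩ := shortExact_constMap (c := c) (shortExact_mk_kernel (Projective.π A))
    obtain ⟨G, hG⟩ := (hX A hA).exists_extension hse F
    refine ⟨ModuleCat.ofHom ((G.f q).hom.codRestrict _ fun x ↦ ?_), ?_⟩
    · rw [LinearMap.mem_ker, ← f_del]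
      exact map_zero _
    · ext x
      exact Eq.trans congr((($hG).f q).hom x) congr($hF x)
  · intro i j k hij hjk x hx
    let P : ModuleCat.{u} R := ModuleCat.of R R
    have : Projective P := inferInstance
    obtain ⟨F, hF⟩ := exists_const_hom (B := P) X hjk (LinearMap.toSpanSingleton R _ x) fun b ↦ by
      rw [LinearMap.toSpanSingleton_apply, map_smul, hx, smul_zero]
    obtain ⟨w, hse⟩ := shortExact_double (c := c) P
    obtain ⟨G, hG⟩ := (hX P (h𝓐.left_of_projective P)).exists_extension hse F
    refine ⟨(G.f i).hom ((0, 1) : P × P), ?_⟩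
    have h₁ : (G.f j).hom ((1, 0) : P × P) = (F.f j).hom (1 : R) := by
      rw [← hG]
      rfl
    rw [hF] at h₁
    exact (f_del G i j ((0, 1) : P × P)).symm.trans
      ((congrArg (G.f j).hom (del_doubleComplex hij _)).trans (h₁.trans (one_smul R x)))

end Orthogonality

section Generation

variable {R : Type u} [Ring R] {ι : Type} {c : ComplexShape ι}

variable (R c) in
/-- Presentations of the `T`-small complexes as quotients of free modules. -/
structure Presentation (T : ι → ι → Type u) where
  /-- The index such that the components are generated by the types `T base q`. -/
  base : ι
  /-- The relations. -/
  rel (q : ι) : Submodule R (T base q →₀ R)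
  /-- The differentials. -/
  diff (i j : ι) : ((T base i →₀ R) ⧸ rel i) →ₗ[R] ((T base j →₀ R) ⧸ rel j)
  shape (i j) : ¬ c.Rel i j → diff i j = 0
  diff_comp_diff (i j k) : c.Rel i j → c.Rel j k → diff j k ∘ₗ diff i j = 0

variable {T : ι → ι → Type u}

/-- The complex defined by a presentation. -/
noncomputable def Presentation.complex (P : Presentation R c T) :
    HomologicalComplex (ModuleCat.{u} R) c :=
  mkComplex c (fun q ↦ (T P.base q →₀ R) ⧸ P.rel q) P.diff P.shape P.diff_comp_diff

lemma IsSmall.exists_presentation {S : HomologicalComplex (ModuleCat.{u} R) c}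
    (hS : IsSmall T S) : ∃ P : Presentation R c T, Nonempty (P.complex ≅ S) := by
  obtain ⟨q₀, hf⟩ := hS
  choose f hf using hf
  let φ (q : ι) : (T q₀ q →₀ R) →ₗ[R] S.X q := Finsupp.linearCombination R (f q)
  have hφ (q : ι) : Function.Surjective (φ q) := by
    rw [← LinearMap.range_eq_top, Finsupp.range_linearCombination, (hf q).range_eq,
      Submodule.span_univ]
  let e (q : ι) := (φ q).quotKerEquivOfSurjective (hφ q)
  let P : Presentation R c T :=
    { base := q₀
      rel q := LinearMap.ker (φ q)
      diff i j := (e j).symm.toLinearMap ∘ₗ del S i j ∘ₗ (e i).toLinearMap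
      shape i j h := by
        have : del S i j = 0 := congrArg ModuleCat.Hom.hom (S.shape i j h)
        rw [this, LinearMap.zero_comp, LinearMap.comp_zero]
      diff_comp_diff i j k _ _ := by
        refine LinearMap.ext fun x ↦ ?_
        simp [del_del] }
  refine ⟨P, ⟨HomologicalComplex.Hom.isoOfComponents (fun q ↦ (e q).toModuleIso)
    fun i j _ ↦ ?_⟩⟩
  refine ModuleCat.hom_ext (LinearMap.ext fun x ↦ ?_)
  exact ((e j).apply_symm_apply _).symm

/-- A deconstructible class generates a complete cotorsion pair. -/
theorem IsDeconstructible.isComplete {F : Set (HomologicalComplex (ModuleCat.{u} R) c)}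
    (hF : IsDeconstructible T F) :
    IsCompleteCotorsionPair {C | ∀ Y, (∀ X ∈ F, ExtSplits X Y) → ExtSplits C Y}
      {Y | ∀ X ∈ F, ExtSplits X Y} := by
  let S (P : {P : Presentation R c T // P.complex ∈ F}) := P.1.complex
  have h (Y : HomologicalComplex (ModuleCat.{u} R) c) :
      (∀ P, ExtSplits (S P) Y) ↔ ∀ X ∈ F, ExtSplits X Y := by
    refine ⟨fun hY X hX ↦ hF.extSplits (fun Z hZ hZs ↦ ?_) hX, fun hY P ↦ hY _ P.2⟩
    obtain ⟨P, ⟨e⟩⟩ := hZs.exists_presentation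
    exact (hY ⟨P, hF.of_iso e.symm hZ⟩).of_iso_left e
  simpa only [h] using isComplete_of_family (S := S) (isSeparator_freeComplex (R := R) (c := c))

end Generation

section Completeness

variable {R : Type u} [Ring R] {ι : Type} {c : ComplexShape ι} {𝓐 𝓑 : Set (ModuleCat.{u} R)}
  (h𝓐 : IsPureCotorsionPair 𝓐 𝓑)

include h𝓐

theorem isComplete_cokerClass_inter_exactClass (hc : ∀ q, ∃ p, c.Rel p q) :
    IsCompleteCotorsionPair (cokerClass c 𝓐 ∩ exactClass R c)
      {Y | ∀ X ∈ cokerClass c 𝓐 ∩ exactClass R c, ExtSplits X Y} := by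
  convert (isDeconstructible_exact h𝓐).isComplete using 1
  refine Set.Subset.antisymm (fun X hX Y hY ↦ hY X hX) fun X hX ↦ ?_
  exact mem_of_extSplits_const h𝓐 fun B hB ↦ hX _ fun Z hZ ↦ extSplits_const h𝓐 hc hZ hB

theorem isComplete_kerClass_inter_exactClass (hc : ∀ q, ∃ p, c.Rel p q)
    (hc' : ∀ q, ∃ r, c.Rel q r) :
    IsCompleteCotorsionPair {X | ∀ Y ∈ kerClass c 𝓑 ∩ exactClass R c, ExtSplits X Y}
      (kerClass c 𝓑 ∩ exactClass R c) := by
  have h : {Y | ∀ X ∈ cokerClass c 𝓐 ∩ zeroClass R c, ExtSplits X Y} =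
      kerClass c 𝓑 ∩ exactClass R c :=
    Set.Subset.antisymm
      (fun Y hY ↦ mem_of_forall_zeroClass h𝓐 fun A hA ↦ hY _ (constComplex_mem h𝓐 hA))
      fun Y hY X hX ↦ extSplits_of_mem_zeroClass h𝓐 hc hc' hX hY
  rw [← h]
  exact (isDeconstructible_zero h𝓐).isComplete

end Completeness

section Periodic

variable {R : Type u} [Ring R]

lemma isPureCotorsionPair_of_isCotorsionPair [HasExt.{w} (ModuleCat.{u} R)]
    {𝓐 𝓑 : Set (ModuleCat.{u} R)} (h : IsCotorsionPair 𝓐 𝓑) (hher : ClosedUnderKernelsOfEpis 𝓐)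
    (hpure : ClosedUnderPureQuotients R 𝓐) : IsPureCotorsionPair 𝓐 𝓑 where
  mem_left_iff A := by
    rw [h.1]
    exact forall₂_congr fun B _ ↦ subsingleton_ext_iff_extSplits A B
  mem_right_iff B := by
    rw [← h.2]
    exact forall₂_congr fun A _ ↦ subsingleton_ext_iff_extSplits A B
  kernel_mem := hher
  pure_mem := hpure

lemma rightPerp_eq {𝓨 : Type u} [Category.{v} 𝓨] [Abelian 𝓨] [HasExt.{w} 𝓨] [EnoughInjectives 𝓨]
    (Γ : Set 𝓨) : rightPerp Γ = {Y | ∀ C ∈ Γ, ExtSplits C Y} :=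
  Set.ext fun Y ↦ forall₂_congr fun C _ ↦ subsingleton_ext_iff_extSplits C Y

lemma leftPerp_eq {𝓨 : Type u} [Category.{v} 𝓨] [Abelian 𝓨] [HasExt.{w} 𝓨] [EnoughInjectives 𝓨]
    (Δ : Set 𝓨) : leftPerp Δ = {Y | ∀ D ∈ Δ, ExtSplits Y D} :=
  Set.ext fun Y ↦ forall₂_congr fun D _ ↦ subsingleton_ext_iff_extSplits Y D

variable {N : ℕ}

lemma rel_down_iff {q r : ZMod N} : (ComplexShape.down (ZMod N)).Rel q r ↔ r = q - 1 :=
  eq_sub_iff_add_eq.symm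

lemma mem_exactClass_iff (X : PeriodicComplexes R N) :
    X ∈ exactClass R (ComplexShape.down (ZMod N)) ↔ ∀ q, IsZero (X.homology q) := by
  have h (q : ZMod N) : IsZero (X.homology q) ↔
      ∀ x, del X q (q - 1) x = 0 → ∃ y, del X (q + 1) q y = x := by
    rw [← HomologicalComplex.exactAt_iff_isZero_homology,
      X.exactAt_iff' (q + 1) q (q - 1) (ComplexShape.prev_eq' _ rfl)
        (ComplexShape.next_eq' _ (sub_add_cancel q 1)), ShortComplex.moduleCat_exact_iff]
    rfl
  simp only [h]
  refine ⟨fun hX q ↦ hX _ _ _ rfl (sub_add_cancel q 1), fun hX i j k hij hjk ↦ ?_⟩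
  obtain rfl : j + 1 = i := hij
  obtain rfl : k = j - 1 := rel_down_iff.1 hjk
  exact hX j

variable {𝓐 𝓑 : Set (ModuleCat.{u} R)} (h𝓐 : IsPureCotorsionPair 𝓐 𝓑)

include h𝓐

lemma IsPureCotorsionPair.phiPeriodic_eq : PhiPeriodic R N 𝓐 =
    cokerClass (ComplexShape.down (ZMod N)) 𝓐 ∩ exactClass R (ComplexShape.down (ZMod N)) := by
  ext X
  rw [Set.mem_inter_iff, mem_exactClass_iff]
  refine forall_and.trans (and_congr_left' ?_)
  have h (q : ZMod N) : cokernel (X.d q (q - 1)) ∈ 𝓐 ↔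
      ModuleCat.of R (X.X (q - 1) ⧸ LinearMap.range (del X q (q - 1))) ∈ 𝓐 :=
    ⟨h𝓐.left_of_iso (ModuleCat.cokernelIsoRangeQuotient _),
      h𝓐.left_of_iso (ModuleCat.cokernelIsoRangeQuotient _).symm⟩
  refine (forall_congr' h).trans ⟨fun hX p q hpq ↦ ?_, fun hX q ↦ hX _ _ (sub_add_cancel q 1)⟩
  obtain rfl := rel_down_iff.1 hpq
  exact hX p

lemma IsPureCotorsionPair.psiPeriodic_eq : PsiPeriodic R N 𝓑 =
    kerClass (ComplexShape.down (ZMod N)) 𝓑 ∩ exactClass R (ComplexShape.down (ZMod N)) := by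
  ext X
  rw [Set.mem_inter_iff, mem_exactClass_iff]
  refine forall_and.trans (and_congr_left' ?_)
  have h (q : ZMod N) : kernel (X.d q (q - 1)) ∈ 𝓑 ↔
      ModuleCat.of R (LinearMap.ker (del X q (q - 1))) ∈ 𝓑 :=
    ⟨h𝓐.right_of_iso (ModuleCat.kernelIsoKer _), h𝓐.right_of_iso (ModuleCat.kernelIsoKer _).symm⟩
  refine (forall_congr' h).trans ⟨fun hX p q hpq ↦ ?_, fun hX q ↦ hX _ _ (sub_add_cancel q 1)⟩
  obtain rfl := rel_down_iff.1 hpq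
  exact hX p

end Periodic

end PeriodicCotorsion

theorem periodic_cotorsionPairs_complete
    (k : Type u) [Field k] [Algebra k R] (hN : 1 ≤ N)
    [HasExt.{w} (ModuleCat.{u} R)] [HasExt.{w'} (PeriodicComplexes R N)]
    (𝓐 𝓑 : Set (ModuleCat.{u} R))
    (h : IsCotorsionPair 𝓐 𝓑) (hher : IsHereditary 𝓐 𝓑)
    (hpure : ClosedUnderPureQuotients R 𝓐)
    (hgen : ∃ 𝓒 : Set (ModuleCat.{u} R), 𝓑 = rightPerp 𝓒) :
    IsCompleteCotorsionPair (PhiPeriodic R N 𝓐) (rightPerp (PhiPeriodic R N 𝓐)) ∧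
    IsCompleteCotorsionPair (leftPerp (PsiPeriodic R N 𝓑)) (PsiPeriodic R N 𝓑) := by
  have h𝓐 := PeriodicCotorsion.isPureCotorsionPair_of_isCotorsionPair h hher.1 hpure
  have : EnoughInjectives (PeriodicComplexes R N) := IsGrothendieckAbelian.enoughInjectives
  have hc (q : ZMod N) : ∃ p, (ComplexShape.down (ZMod N)).Rel p q := ⟨q + 1, rfl⟩
  have hc' (q : ZMod N) : ∃ r, (ComplexShape.down (ZMod N)).Rel q r := ⟨q - 1, sub_add_cancel q 1⟩
  rw [PeriodicCotorsion.rightPerp_eq, PeriodicCotorsion.leftPerp_eq, h𝓐.phiPeriodic_eq,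
    h𝓐.psiPeriodic_eq]
  exact ⟨PeriodicCotorsion.isComplete_cokerClass_inter_exactClass h𝓐 hc,
    PeriodicCotorsion.isComplete_kerClass_inter_exactClass h𝓐 hc hc'⟩
end
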